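/- Let B, A_1,…,A_m be convex bodies in ℝ^n and let 0 ≤ k ≤ m ≤ n. Then vol(B)·V(B[n−m], A_1,…,A_m) ≤ (m!/(k!(m−k)!)) · V(B[n−k], A_1,…,A_k) · V(B[n−m+k], A_{k+1},…,A_m). -/

import Mathlib

open MeasureTheory
open scoped Pointwise

namespace ConvexPaper

abbrev En (n : ℕ) := EuclideanSpace ℝ (Fin n)

/-- The mixed volume of a list of `n` subsets of `ℝ^n`, via the polarization formula
`V(K_1,…,K_n) = (1/n!) Σ_{∅ ≠ S ⊆ [n]} (−1)^{n−|S|} vol(Σ_{i∈S} K_i)`. -/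
noncomputable def mixedVol (n : ℕ) (L : List (Set (En n))) : ℝ :=
  ((n.factorial : ℝ))⁻¹ *
    ∑ S ∈ (Finset.range n).powerset.filter (fun S => S.Nonempty),
      (-1 : ℝ) ^ (n - S.card) * (volume (∑ i ∈ S, L.getD i 0)).toReal

end ConvexPaper

namespace ConvexPaper

section rk
variable {L : Type*} [Field L]

/-- rank of a set over a subfield -/
noncomputable def rk (K : Subfield L) (s : Set L) : ℕ := Set.finrank K s

theorem rk_le_of_subset_span {K : Subfield L} {s t : Set L} (ht : t.Finite)
    (h : s ⊆ Submodule.span K t) : rk K s ≤ rk K t := by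
  have : Module.Finite K (Submodule.span K t) := Module.Finite.span_of_finite K ht
  exact Submodule.finrank_mono (Submodule.span_le.2 h)

theorem rk_mono {K : Subfield L} {s t : Set L} (ht : t.Finite) (h : s ⊆ t) : rk K s ≤ rk K t :=
  rk_le_of_subset_span ht (h.trans Submodule.subset_span)

theorem rk_le_card {K : Subfield L} (s : Finset L) : rk K (s : Set L) ≤ s.card :=
  finrank_span_finset_le_card s

theorem exists_basis_subset (K : Subfield L) (s : Set L) (hs : s.Finite) :
    ∃ b : Finset L, (b : Set L) ⊆ s ∧ b.card = rk K s ∧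
      LinearIndependent K (fun v : b => (v : L)) ∧ s ⊆ Submodule.span K (b : Set L) := by
  obtain ⟨b, hb, hspan, hli⟩ := exists_linearIndependent K s
  have hbf : b.Finite := hs.subset hb
  lift b to Finset L using hbf
  refine ⟨b, hb, ?_, hli, ?_⟩
  · have h1 := finrank_span_finset_eq_card (R := K) (s := b) hli
    rw [hspan] at h1
    exact h1.symm
  · rw [hspan]; exact Submodule.subset_span

theorem card_le_rk {K : Subfield L} {s : Set L} (hs : s.Finite) {b : Finset L}
    (hb : (b : Set L) ⊆ Submodule.span K s)
    (hli : LinearIndependent K (fun v : b => (v : L))) : b.card ≤ rk K s := by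
  have h1 := finrank_span_finset_eq_card (R := K) (s := b) hli
  rw [← h1]
  exact rk_le_of_subset_span hs hb

theorem rk_mul_left {K : Subfield L} (a : L) (ha : a ≠ 0) (s : Set L) :
    rk K ((fun x => a * x) '' s) = rk K s := by
  let e : L ≃ₗ[K] L :=
    { toFun := fun x => a * x
      invFun := fun x => a⁻¹ * x
      map_add' := fun x y => by ring
      map_smul' := fun c x => by simp [Subfield.smul_def]; ring
      left_inv := fun x => by field_simp
      right_inv := fun x => by field_simp }
  have : (fun x => a * x) '' s = e '' s := rfl
  rw [rk, rk, this, Set.finrank, Set.finrank]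
  have h2 : Submodule.span K (e '' s) = (Submodule.span K s).map (e : L →ₗ[K] L) := by
    rw [Submodule.map_span]; rfl
  rw [h2]
  exact LinearEquiv.finrank_map_eq e _

/-- The rank over a bigger field is smaller. -/
theorem rk_anti {K F : Subfield L} (h : K ≤ F) {s : Set L} (hs : s.Finite) :
    rk F s ≤ rk K s := by
  obtain ⟨b, hbs, hbc, hli, hsp⟩ := exists_basis_subset K s hs
  rw [← hbc]
  refine (rk_le_of_subset_span b.finite_toSet ?_).trans (rk_le_card b)
  intro x hx
  have := hsp hx
  refine Submodule.span_induction (p := fun x _ => x ∈ Submodule.span F (b : Set L)) ?_ ?_ ?_ ?_ this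
  · intro x hx; exact Submodule.subset_span hx
  · exact Submodule.zero_mem _
  · intro x y _ _ hx hy; exact Submodule.add_mem _ hx hy
  · intro a x _ hx
    exact Submodule.smul_mem _ (⟨a, h a.2⟩ : F) hx

end rk
end ConvexPaper

namespace ConvexPaper

section chain
open Polynomial
variable {L : Type*} [Field L]

/-- Dependence of too many vectors over a domain. -/
theorem exists_dep {R : Type*} [CommRing R] [IsDomain R] {ι κ : Type*} [Fintype ι] [Fintype κ]
    (a : ι → κ → R) (h : Fintype.card κ < Fintype.card ι) :
    ∃ P : ι → R, (∃ i, P i ≠ 0) ∧ ∀ v, ∑ i, P i * a i v = 0 := by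
  classical
  have hn : ¬ LinearIndependent R a := by
    intro hli
    have := hli.fintype_card_le_finrank
    rw [Module.finrank_fintype_fun_eq_card] at this
    omega
  rw [Fintype.linearIndependent_iff] at hn
  push Not at hn
  obtain ⟨P, hP, i, hi⟩ := hn
  refine ⟨P, ⟨i, hi⟩, fun v => ?_⟩
  have := congrFun hP v
  simpa using this

theorem mem_span_finset_exists {K : Subfield L} {b : Finset L} {x : L}
    (hx : x ∈ Submodule.span K (b : Set L)) : ∃ κ : b → K, x = ∑ v, (κ v : L) * (v : L) := by
  rw [Submodule.mem_span_finset'] at hx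
  obtain ⟨f, hf⟩ := hx
  exact ⟨f, by rw [← hf]; rfl⟩

theorem poly_coords {K : Subfield L} {b : Finset L} (f : L[X])
    (hf : ∀ n, f.coeff n ∈ Submodule.span K (b : Set L)) :
    ∃ a : b → K[X], f = ∑ v, (a v).map K.subtype * C (v : L) := by
  choose κ hκ using fun n => mem_span_finset_exists (hf n)
  refine ⟨fun v => ∑ n ∈ f.support, monomial n (κ n v), ?_⟩
  ext n
  simp only [finsetSum_coeff, coeff_mul_C, coeff_map, coeff_monomial]
  by_cases hn : n ∈ f.support
  · rw [hκ n]
    refine Finset.sum_congr rfl fun v _ => ?_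
    simp [Finset.sum_ite_eq', mem_support_iff.1 hn]
  · simp [notMem_support_iff.1 hn]

theorem dep_poly {K : Subfield L} {b : Finset L} {ι : Type*} [Fintype ι] (f : ι → L[X])
    (hf : ∀ i n, (f i).coeff n ∈ Submodule.span K (b : Set L)) (h : b.card < Fintype.card ι) :
    ∃ P : ι → K[X], (∃ i, P i ≠ 0) ∧ ∑ i, (P i).map K.subtype * f i = 0 := by
  choose a ha using fun i => poly_coords (f i) (hf i)
  obtain ⟨P, hP, hPa⟩ := exists_dep a (by simpa using h)
  refine ⟨P, hP, ?_⟩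
  calc ∑ i, (P i).map K.subtype * f i
      = ∑ i, ∑ v, (P i * a i v).map K.subtype * C (v : L) := by
        refine Finset.sum_congr rfl fun i _ => ?_
        rw [ha i, Finset.mul_sum]
        exact Finset.sum_congr rfl fun v _ => by simp [mul_assoc]
    _ = ∑ v, (∑ i, P i * a i v).map K.subtype * C (v : L) := by
        rw [Finset.sum_comm]
        refine Finset.sum_congr rfl fun v _ => ?_
        rw [Polynomial.map_sum, Finset.sum_mul]
    _ = 0 := by simp [hPa]

/-- Families with controlled leading terms at `τ`. -/
structure GoodFam (K' : Subfield L) (τ : L) {ι : Type*} [Fintype ι] (f : ι → L[X]) (c : ι → ℕ) :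
    Prop where
  low : ∀ i j, j < c i → (taylor τ (f i)).coeff j = 0
  li : ∀ c0, ∀ κ : ι → L, (∀ i, κ i ∈ K') →
    (∑ i, if c i = c0 then κ i * (taylor τ (f i)).coeff c0 else 0) = 0 → ∀ i, c i = c0 → κ i = 0

theorem GoodFam.indep {K K' : Subfield L} {τ : L}
    (htr : ∀ p : K[X], eval τ (p.map K.subtype) = 0 → p = 0)
    (hK' : ∀ p : K[X], eval τ (p.map K.subtype) ∈ K')
    {ι : Type*} [Fintype ι] {f : ι → L[X]} {c : ι → ℕ} (hg : GoodFam K' τ f c)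
    (P : ι → K[X]) (hP : ∑ i, (P i).map K.subtype * f i = 0) : ∀ i, P i = 0 := by
  suffices H : ∀ c0, ∀ i, c i = c0 → P i = 0 from fun i => H _ i rfl
  intro c0
  induction c0 using Nat.strong_induction_on with
  | _ c0 ih =>
  have h1 : ∑ i, (taylor τ ((P i).map K.subtype * f i)).coeff c0 = 0 := by
    rw [← finsetSum_coeff, ← map_sum, hP]; simp
  have h2 : ∀ i, (taylor τ ((P i).map K.subtype * f i)).coeff c0 =
      if c i = c0 then eval τ ((P i).map K.subtype) * (taylor τ (f i)).coeff c0 else 0 := by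
    intro i
    rcases lt_trichotomy (c i) c0 with h | h | h
    · rw [if_neg h.ne, ih _ h i rfl]; simp
    · rw [if_pos h, taylor_mul, coeff_mul]
      rw [Finset.sum_eq_single (0, c0)]
      · rw [taylor_coeff_zero]
      · rintro ⟨x, y⟩ hxy hne
        rw [Finset.HasAntidiagonal.mem_antidiagonal] at hxy
        simp only at hxy ⊢
        rw [hg.low i y, mul_zero]
        rcases Nat.eq_zero_or_pos x with hx | hx
        · exact absurd (by rw [hx] at hxy ⊢; simp at hxy; rw [hxy]) hne
        · omega
      · intro hh; exact absurd (by simp) hh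
    · rw [if_neg h.ne', taylor_mul, coeff_mul]
      refine Finset.sum_eq_zero ?_
      rintro ⟨x, y⟩ hxy
      rw [Finset.HasAntidiagonal.mem_antidiagonal] at hxy
      simp only at hxy ⊢
      rw [hg.low i y (by omega), mul_zero]
  rw [Finset.sum_congr rfl fun i _ => h2 i] at h1
  intro i hi
  exact htr _ (hg.li c0 (fun i => eval τ ((P i).map K.subtype)) (fun i => hK' _) h1 i hi)

theorem GoodFam.card_le {K K' : Subfield L} {τ : L}
    (htr : ∀ p : K[X], eval τ (p.map K.subtype) = 0 → p = 0)
    (hK' : ∀ p : K[X], eval τ (p.map K.subtype) ∈ K')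
    {ι : Type*} [Fintype ι] {f : ι → L[X]} {c : ι → ℕ} (hg : GoodFam K' τ f c)
    {V : Set L} (hV : V.Finite) (hf : ∀ i n, (f i).coeff n ∈ Submodule.span K V) :
    Fintype.card ι ≤ rk K V := by
  obtain ⟨b, hbs, hbc, hli, hsp⟩ := exists_basis_subset K V hV
  by_contra hlt
  push Not at hlt
  rw [← hbc] at hlt
  obtain ⟨P, ⟨i, hi⟩, hP⟩ := dep_poly (K := K) (b := b) f
    (fun i n => Submodule.span_le.2 hsp (hf i n)) hlt
  exact hi (hg.indep htr hK' P hP i)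

theorem exists_max_goodFam {K K' : Subfield L} {τ : L}
    (htr : ∀ p : K[X], eval τ (p.map K.subtype) = 0 → p = 0)
    (hK' : ∀ p : K[X], eval τ (p.map K.subtype) ∈ K')
    {V : Set L} (hV : V.Finite) :
    ∃ (N : ℕ) (f : Fin N → L[X]) (c : Fin N → ℕ), GoodFam K' τ f c ∧
      (∀ i n, (f i).coeff n ∈ Submodule.span K V) ∧
      (∀ (F : L[X]) (c0 : ℕ), (∀ n, F.coeff n ∈ Submodule.span K V) →
        (∀ j < c0, (taylor τ F).coeff j = 0) →
        ∃ κ : Fin N → L, (∀ i, κ i ∈ K') ∧ (taylor τ F).coeff c0 =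
          ∑ i, if c i = c0 then κ i * (taylor τ (f i)).coeff c0 else 0) := by
  classical
  let P : ℕ → Prop := fun N => ∃ (f : Fin N → L[X]) (c : Fin N → ℕ), GoodFam K' τ f c ∧
      (∀ i n, (f i).coeff n ∈ Submodule.span K V)
  have hP0 : P 0 := ⟨Fin.elim0, Fin.elim0, ⟨fun i => i.elim0, fun _ _ _ _ i => i.elim0⟩,
    fun i => i.elim0⟩
  have hPb : ∀ N, P N → N ≤ rk K V := by
    rintro N ⟨f, c, hg, hf⟩
    simpa using hg.card_le htr hK' hV hf
  let N := Nat.findGreatest P (rk K V)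
  have hN : P N := Nat.findGreatest_spec (Nat.zero_le _) hP0
  have hmax : ¬ P (N + 1) := by
    intro h
    have h1 := Nat.le_findGreatest (hPb _ h) h
    change N + 1 ≤ N at h1
    omega
  obtain ⟨f, c, hg, hf⟩ := hN
  refine ⟨N, f, c, hg, hf, ?_⟩
  intro F c0 hF hlow
  by_contra hno
  push Not at hno
  apply hmax
  refine ⟨Fin.cons F f, Fin.cons c0 c, ⟨?_, ?_⟩, ?_⟩
  · intro i
    refine Fin.cases ?_ (fun i => ?_) i
    · simpa using hlow
    · simpa using hg.low i
  · intro c1 κ hκ hsum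
    rw [Fin.sum_univ_succ] at hsum
    simp only [Fin.cons_zero, Fin.cons_succ] at hsum
    have hk0 : c0 = c1 → κ 0 = 0 := by
      intro hc
      by_contra hk
      subst hc
      rw [if_pos rfl] at hsum
      refine hno (fun i => -(κ 0)⁻¹ * κ i.succ)
        (fun i => K'.mul_mem (K'.neg_mem (K'.inv_mem (hκ 0))) (hκ _)) ?_
      have h3 : ∀ i : Fin N, (if c i = c0 then -(κ 0)⁻¹ * κ i.succ * (taylor τ (f i)).coeff c0 else 0)
          = -(κ 0)⁻¹ * (if c i = c0 then κ i.succ * (taylor τ (f i)).coeff c0 else 0) := by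
        intro i; split_ifs <;> ring
      rw [Finset.sum_congr rfl fun i _ => h3 i, ← Finset.mul_sum]
      rw [eq_neg_of_add_eq_zero_right hsum]
      field_simp
    have hrest : (∑ i : Fin N, if c i = c1 then κ i.succ * (taylor τ (f i)).coeff c1 else 0) = 0 := by
      by_cases hc : c0 = c1
      · rw [if_pos hc, hk0 hc] at hsum; simpa using hsum
      · rw [if_neg hc] at hsum; simpa using hsum
    intro i
    refine Fin.cases ?_ (fun i => ?_) i
    · simpa using hk0
    · simpa using hg.li c1 (fun i => κ i.succ) (fun i => hκ _) hrest i
  · intro i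
    refine Fin.cases ?_ (fun i => ?_) i
    · simpa using hF
    · simpa using hf i

theorem common_denom {K K' : Subfield L} {τ : L}
    (hfr : ∀ y ∈ K', ∃ p q : K[X], eval τ (q.map K.subtype) ≠ 0 ∧
      eval τ (q.map K.subtype) * y = eval τ (p.map K.subtype))
    {ι : Type*} [Fintype ι] (κ : ι → L) (hκ : ∀ i, κ i ∈ K') :
    ∃ (q : K[X]) (p : ι → K[X]), eval τ (q.map K.subtype) ≠ 0 ∧
      ∀ i, eval τ (q.map K.subtype) * κ i = eval τ ((p i).map K.subtype) := by
  classical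
  choose p q hq hpq using fun i => hfr (κ i) (hκ i)
  refine ⟨∏ i, q i, fun i => (∏ j ∈ Finset.univ.erase i, q j) * p i, ?_, ?_⟩
  · rw [Polynomial.map_prod, eval_prod]
    exact Finset.prod_ne_zero_iff.2 fun i _ => hq i
  · intro i
    rw [← Finset.mul_prod_erase _ _ (Finset.mem_univ i)]
    simp only [Polynomial.map_mul, eval_mul, ← hpq]
    ring

theorem coeff_taylor_mul_low {τ : L} {p F : L[X]} {c0 : ℕ}
    (hlow : ∀ j < c0, (taylor τ F).coeff j = 0) :
    (∀ j < c0, (taylor τ (p * F)).coeff j = 0) ∧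
    (taylor τ (p * F)).coeff c0 = eval τ p * (taylor τ F).coeff c0 := by
  rw [taylor_mul]
  constructor
  · intro j hj
    rw [coeff_mul]
    refine Finset.sum_eq_zero ?_
    rintro ⟨x, y⟩ hxy
    rw [Finset.HasAntidiagonal.mem_antidiagonal] at hxy
    simp only at hxy ⊢
    rw [hlow y (by omega), mul_zero]
  · rw [coeff_mul, Finset.sum_eq_single (0, c0)]
    · rw [taylor_coeff_zero]
    · rintro ⟨x, y⟩ hxy hne
      rw [Finset.HasAntidiagonal.mem_antidiagonal] at hxy
      simp only at hxy ⊢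
      rw [hlow y, mul_zero]
      rcases Nat.eq_zero_or_pos x with hx | hx
      · exact absurd (by rw [hx] at hxy ⊢; simp at hxy; rw [hxy]) hne
      · omega
    · intro hh; exact absurd (by simp) hh

theorem coeff_mul_mem_span {K : Subfield L} {V : Set L} (p : K[X]) {F : L[X]}
    (hF : ∀ n, F.coeff n ∈ Submodule.span K V) (n : ℕ) :
    (p.map K.subtype * F).coeff n ∈ Submodule.span K V := by
  rw [coeff_mul]
  refine Submodule.sum_mem _ fun x _ => ?_
  rw [coeff_map]
  exact Submodule.smul_mem _ (p.coeff x.1) (hF _)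

theorem max_goodFam_rank {K K' : Subfield L} {τ : L}
    (htr : ∀ p : K[X], eval τ (p.map K.subtype) = 0 → p = 0)
    (hfr : ∀ y ∈ K', ∃ p q : K[X], eval τ (q.map K.subtype) ≠ 0 ∧
      eval τ (q.map K.subtype) * y = eval τ (p.map K.subtype))
    {V : Set L} (hV : V.Finite) {N : ℕ} {f : Fin N → L[X]} {c : Fin N → ℕ}
    (hg : GoodFam K' τ f c)
    (hf : ∀ i n, (f i).coeff n ∈ Submodule.span K V)
    (hmax : ∀ (F : L[X]) (c0 : ℕ), (∀ n, F.coeff n ∈ Submodule.span K V) →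
        (∀ j < c0, (taylor τ F).coeff j = 0) →
        ∃ κ : Fin N → L, (∀ i, κ i ∈ K') ∧ (taylor τ F).coeff c0 =
          ∑ i, if c i = c0 then κ i * (taylor τ (f i)).coeff c0 else 0) :
    rk K V ≤ N := by
  classical
  obtain ⟨M, hM⟩ : ∃ M, ∀ i, c i < M := ⟨∑ i, (c i + 1), fun i =>
    Finset.single_le_sum (f := fun i => c i + 1) (fun _ _ => Nat.zero_le _) (Finset.mem_univ i)⟩
  have key : ∀ k, ∀ F : L[X], (∀ n, F.coeff n ∈ Submodule.span K V) →
      (∀ j, j + k < M → (taylor τ F).coeff j = 0) →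
      ∃ (q : K[X]) (P : Fin N → K[X]), q ≠ 0 ∧
        q.map K.subtype * F = ∑ i, (P i).map K.subtype * f i := by
    intro k
    induction k with
    | zero =>
      intro F hF hlow
      have h0 : ∀ j, (taylor τ F).coeff j = 0 := by
        intro j
        induction j using Nat.strong_induction_on with
        | _ j ih =>
        by_cases hj : j < M
        · exact hlow j (by simpa using hj)
        · obtain ⟨κ, -, hκ⟩ := hmax F j hF ih
          rw [hκ]
          refine Finset.sum_eq_zero fun i _ => ?_
          rw [if_neg]
          have := hM i
          omega
      have hF0 : F = 0 := by
        apply taylor_injective τ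
        ext j
        simp [h0 j]
      exact ⟨1, 0, one_ne_zero, by simp [hF0]⟩
    | succ k ih =>
      intro F hF hlow
      by_cases hk : M ≤ k
      · exact ih F hF fun j hj => by omega
      have hlow' : ∀ j < M - (k + 1), (taylor τ F).coeff j = 0 := fun j hj => hlow j (by omega)
      set c0 := M - (k + 1) with hc0
      obtain ⟨κ, hκ, hκs⟩ := hmax F c0 hF hlow'
      obtain ⟨q, p, hq, hp⟩ := common_denom hfr κ hκ
      let F1 := q.map K.subtype * F - ∑ i, if c i = c0 then (p i).map K.subtype * f i else 0
      have hF1 : ∀ n, F1.coeff n ∈ Submodule.span K V := by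
        intro n
        simp only [F1, coeff_sub, finsetSum_coeff]
        refine Submodule.sub_mem _ (coeff_mul_mem_span q hF n) (Submodule.sum_mem _ fun i _ => ?_)
        split_ifs
        · exact coeff_mul_mem_span _ (hf i) n
        · simp
      have hF2 : ∀ j, j + k < M → (taylor τ F1).coeff j = 0 := by
        intro j hj
        have hterm : ∀ i, (taylor τ (if c i = c0 then (p i).map K.subtype * f i else 0)).coeff j =
            if c i = c0 then (if j = c0 then
              eval τ ((p i).map K.subtype) * (taylor τ (f i)).coeff c0 else 0) else 0 := by
          intro i
          by_cases hi : c i = c0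
          · rw [if_pos hi, if_pos hi]
            have := coeff_taylor_mul_low (p := (p i).map K.subtype) (hg.low i)
            rw [hi] at this
            by_cases hjc : j = c0
            · rw [if_pos hjc, hjc, this.2]
            · rw [if_neg hjc, this.1 j (by omega)]
          · rw [if_neg hi, if_neg hi]; simp
        simp only [F1, map_sub, map_sum, coeff_sub, finsetSum_coeff]
        rw [Finset.sum_congr rfl fun i _ => hterm i]
        have h6 := coeff_taylor_mul_low (p := q.map K.subtype) hlow'
        by_cases hjc : j = c0
        · subst hjc
          rw [h6.2, hκs, Finset.mul_sum, sub_eq_zero]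
          refine Finset.sum_congr rfl fun i _ => ?_
          simp only [if_true]
          split_ifs
          · rw [← hp]; ring
          · simp
        · rw [h6.1 j (by omega)]
          simp [hjc]
      obtain ⟨q1, P1, hq1, hP1⟩ := ih F1 hF1 hF2
      refine ⟨q1 * q, fun i => P1 i + if c i = c0 then q1 * p i else 0, ?_, ?_⟩
      · refine mul_ne_zero hq1 ?_
        rintro rfl
        simp at hq
      · have h5 : ∀ i, (P1 i + if c i = c0 then q1 * p i else 0).map K.subtype * f i =
          (P1 i).map K.subtype * f i + q1.map K.subtype *
            (if c i = c0 then (p i).map K.subtype * f i else 0) := by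
          intro i
          split_ifs <;> simp <;> ring
        rw [Finset.sum_congr rfl fun i _ => h5 i, Finset.sum_add_distrib, ← hP1,
          ← Finset.mul_sum]
        simp only [F1, Polynomial.map_mul]
        ring
  obtain ⟨b, hbs, hbc, hli, hsp⟩ := exists_basis_subset K V hV
  by_contra hlt
  push Not at hlt
  rw [← hbc] at hlt
  have hk2 : ∀ v : b, ∃ (q : K[X]) (P : Fin N → K[X]), q ≠ 0 ∧
        q.map K.subtype * C (v : L) = ∑ i, (P i).map K.subtype * f i := by
    intro v
    refine key M _ (fun n => ?_) (fun j hj => by omega)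
    rw [coeff_C]
    split_ifs
    · exact Submodule.subset_span (hbs v.2)
    · exact Submodule.zero_mem _
  choose q P hq hP using hk2
  obtain ⟨lam, ⟨v0, hv0⟩, hlam⟩ := exists_dep P (by simpa using hlt)
  have hz : ∑ v, (lam v * q v).map K.subtype * C (v : L) = 0 := by
    calc ∑ v, (lam v * q v).map K.subtype * C (v : L)
        = ∑ v, ∑ i, (lam v * P v i).map K.subtype * f i := by
          refine Finset.sum_congr rfl fun v _ => ?_
          rw [Polynomial.map_mul, mul_assoc, hP, Finset.mul_sum]
          exact Finset.sum_congr rfl fun i _ => by simp [mul_assoc]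
      _ = ∑ i, (∑ v, lam v * P v i).map K.subtype * f i := by
          rw [Finset.sum_comm]
          refine Finset.sum_congr rfl fun i _ => ?_
          rw [Polynomial.map_sum, Finset.sum_mul]
      _ = 0 := Finset.sum_eq_zero fun i _ => by rw [hlam i]; simp
  have hz2 : ∀ n, ∀ v, (lam v * q v).coeff n = 0 := by
    intro n
    have := congrArg (fun F : L[X] => F.coeff n) hz
    simp only [finsetSum_coeff, coeff_mul_C, coeff_map, coeff_zero] at this
    exact Fintype.linearIndependent_iff.1 hli (fun v => (lam v * q v).coeff n) this
  have : lam v0 * q v0 = 0 := by ext n; simp [hz2 n v0]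
  exact (mul_ne_zero hv0 (hq v0)) this

end chain
end ConvexPaper

namespace ConvexPaper

section chain
open Polynomial
variable {L : Type*} [Field L]

/-- One transcendental adjunction, simultaneously to `K` and `F`. -/
structure FStep (K F K' F' : Subfield L) (τ : L) : Prop where
  le : K ≤ F
  tr : ∀ p : F[X], eval τ (p.map F.subtype) = 0 → p = 0
  evK : ∀ p : K[X], eval τ (p.map K.subtype) ∈ K'
  fr : ∀ y ∈ K', ∃ p q : K[X], eval τ (q.map K.subtype) ≠ 0 ∧
      eval τ (q.map K.subtype) * y = eval τ (p.map K.subtype)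
  evF : ∀ p : F[X], eval τ (p.map F.subtype) ∈ F'

/-- A sequence of transcendental adjunctions. -/
inductive FChain : Subfield L → Subfield L → Subfield L → Subfield L → Prop
  | refl (K F : Subfield L) : FChain K F K F
  | step {K F K' F' K'' F'' : Subfield L} (τ : L) (h : FStep K F K' F' τ)
      (hc : FChain K' F' K'' F'') : FChain K F K'' F''

theorem FStep.leK {K F K' F' : Subfield L} {τ : L} (h : FStep K F K' F' τ) : K ≤ K' := by
  intro x hx
  simpa using h.evK (C ⟨x, hx⟩)

theorem FChain.leK {K F K' F' : Subfield L} (h : FChain K F K' F') : K ≤ K' := by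
  induction h with
  | refl => exact le_rfl
  | step τ h _ ih => exact h.leK.trans ih

theorem FStep.trK {K F K' F' : Subfield L} {τ : L} (h : FStep K F K' F' τ) :
    ∀ p : K[X], eval τ (p.map K.subtype) = 0 → p = 0 := by
  intro p hp
  have h1 : (p.map (Subfield.inclusion h.le)).map F.subtype = p.map K.subtype := by
    rw [Polynomial.map_map]; rfl
  have := h.tr (p.map (Subfield.inclusion h.le)) (by rw [h1, hp])
  exact (Polynomial.map_eq_zero_iff (Subfield.inclusion h.le).injective).1 this

theorem span_mono_field {K F : Subfield L} (h : K ≤ F) {s : Set L} {x : L}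
    (hx : x ∈ Submodule.span K s) : x ∈ Submodule.span F s := by
  refine Submodule.span_induction (p := fun x _ => x ∈ Submodule.span F s) ?_ ?_ ?_ ?_ hx
  · intro x hx; exact Submodule.subset_span hx
  · exact Submodule.zero_mem _
  · intro x y _ _ hx hy; exact Submodule.add_mem _ hx hy
  · intro a x _ hx
    exact Submodule.smul_mem _ (⟨a, h a.2⟩ : F) hx

theorem span_mul_mem {K : Subfield L} {V E : Set L} {x e : L}
    (hx : x ∈ Submodule.span K V) (he : e ∈ E) : x * e ∈ Submodule.span K (V * E) := by
  refine Submodule.span_induction (p := fun x _ => x * e ∈ Submodule.span K (V * E)) ?_ ?_ ?_ ?_ hx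
  · intro x hx; exact Submodule.subset_span (Set.mul_mem_mul hx he)
  · simp
  · intro x y _ _ hx hy; rw [add_mul]; exact Submodule.add_mem _ hx hy
  · intro a x _ hx
    rw [smul_mul_assoc]
    exact Submodule.smul_mem _ a hx

theorem eval_mem_span {K' : Subfield L} {V : Set L} {τ : L} (hτ : τ ∈ K') (F : L[X])
    (hF : ∀ n, F.coeff n ∈ Submodule.span K' V) : eval τ F ∈ Submodule.span K' V := by
  rw [eval_eq_sum_range]
  refine Submodule.sum_mem _ fun i _ => ?_
  rw [mul_comm]
  exact Submodule.smul_mem _ (⟨τ ^ i, K'.pow_mem hτ i⟩ : K') (hF i)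

theorem FStep.exists_split {K F K' F' : Subfield L} {τ : L} (h : FStep K F K' F' τ)
    {V : Set L} (hV : V.Finite) :
    ∃ (O : Finset ℕ) (U : ℕ → Finset L),
      rk K V ≤ ∑ c ∈ O, rk K' (U c : Set L) ∧
      (∀ c ∈ O, (U c : Set L) ⊆ Submodule.span K' V) ∧
      ∀ E : Set L, E.Finite → ∑ c ∈ O, rk F' ((U c : Set L) * E) ≤ rk F (V * E) := by
  classical
  obtain ⟨N, f, c, hg, hf, hmax⟩ := exists_max_goodFam h.trK h.evK hV
  have hN := max_goodFam_rank h.trK h.fr hV hg hf hmax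
  let u : Fin N → L := fun i => (taylor τ (f i)).coeff (c i)
  have hτK : τ ∈ K' := by simpa using h.evK X
  let U : ℕ → Finset L := fun c0 => (Finset.univ.filter fun i => c i = c0).image u
  refine ⟨Finset.univ.image c, U, ?_, ?_, ?_⟩
  · refine hN.trans ?_
    have h1 : N = ∑ c0 ∈ Finset.univ.image c, (Finset.univ.filter fun i => c i = c0).card := by
      rw [← Finset.card_eq_sum_card_image]; simp
    conv_lhs => rw [h1]
    refine Finset.sum_le_sum fun c0 _ => ?_
    -- the u i with c i = c0 are independent
    have hli : LinearIndependent K' (fun i : {i // c i = c0} => u i) := by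
      rw [Fintype.linearIndependent_iff]
      intro κ hκ i
      have := hg.li c0 (fun i => if hi : c i = c0 then (κ ⟨i, hi⟩ : L) else 0) (fun i => by
        split_ifs
        · exact (κ _).2
        · exact K'.zero_mem) ?_ i.1 i.2
      · simp only [i.2, dif_pos] at this
        exact_mod_cast this
      · refine Eq.trans ?_ hκ
        rw [← Finset.sum_filter]
        rw [Finset.sum_subtype (Finset.univ.filter fun i => c i = c0) (p := fun i => c i = c0)
          (by simp)]
        refine Finset.sum_congr rfl fun i _ => ?_
        rw [dif_pos i.2, Subfield.smul_def]
        simp only [u, i.2, smul_eq_mul]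
    have hinj : Function.Injective (fun i : {i // c i = c0} => u i) := hli.injective
    have hUr : (U c0 : Set L) = Set.range (fun i : {i // c i = c0} => u i) := by
      ext x
      simp [U]
    have := finrank_span_eq_card hli
    rw [rk, Set.finrank, hUr, this]
    rw [Fintype.card_subtype]
  · intro c0 _ x hx
    simp only [U, Finset.coe_image, Finset.coe_filter, Finset.mem_univ, true_and] at hx
    obtain ⟨i, -, rfl⟩ := hx
    simp only [u]
    rw [taylor_coeff]
    refine eval_mem_span hτK _ fun n => ?_
    rw [hasseDeriv_coeff, ← nsmul_eq_mul]
    exact Submodule.smul_of_tower_mem _ _ (span_mono_field h.leK (hf i _))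
  · intro E hE
    choose b hbs hbc hli hsp using fun c0 =>
      exists_basis_subset F' ((U c0 : Set L) * E) ((U c0).finite_toSet.mul hE)
    have hb : ∀ c0, ∀ w : b c0, ∃ i e, c i = c0 ∧ e ∈ E ∧ (w : L) = u i * e := by
      intro c0 w
      obtain ⟨y, hy, e, he, hw⟩ := Set.mem_mul.1 (hbs c0 w.2)
      simp only [U, Finset.coe_image, Finset.coe_filter, Finset.mem_univ, true_and] at hy
      obtain ⟨i, hi, rfl⟩ := hy
      exact ⟨i, e, hi, he, hw.symm⟩
    choose I e hI he hw using hb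
    let ι := Σ c0 : (Finset.univ.image c : Finset ℕ), b c0
    let G : ι → L[X] := fun j => f (I j.1 j.2) * C (e j.1 j.2)
    have hGood : GoodFam F' τ G (fun j => (j.1 : ℕ)) := by
      have htay : ∀ j : ι, ∀ m, (taylor τ (G j)).coeff m =
          (taylor τ (f (I j.1 j.2))).coeff m * e j.1 j.2 := by
        intro j m
        simp only [G, taylor_mul, taylor_C, coeff_mul_C]
      constructor
      · intro j m hm
        rw [htay, hg.low _ _ (by rw [hI]; exact hm), zero_mul]
      · intro c0 κ hκ hsum j hj
        obtain ⟨⟨c1, hc1⟩, w⟩ := j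
        simp only at hj
        subst hj
        have h2 : ∑ w : b c1, (κ ⟨⟨c1, hc1⟩, w⟩) * (w : L) = 0 := by
          rw [← hsum, Fintype.sum_sigma]
          rw [Finset.sum_eq_single (⟨c1, hc1⟩ : (Finset.univ.image c : Finset ℕ))]
          · refine Finset.sum_congr rfl fun w _ => ?_
            rw [if_pos rfl, htay]
            simp only
            rw [hw c1 w]
            simp only [u, hI c1 w]
          · intro c2 _ hne
            refine Finset.sum_eq_zero fun w _ => ?_
            rw [if_neg]
            intro hh
            exact hne (Subtype.ext hh)
          · simp
        have := Fintype.linearIndependent_iff.1 (hli c1)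
          (fun w => ⟨κ ⟨⟨c1, hc1⟩, w⟩, hκ _⟩) h2 w
        exact congrArg Subtype.val this
    have hcard := hGood.card_le h.tr h.evF (hV.mul hE) (V := V * E) (by
      intro j n
      simp only [G, coeff_mul_C]
      exact span_mul_mem (span_mono_field h.le (hf _ n)) (he _ _))
    refine le_trans (le_of_eq ?_) hcard
    rw [Fintype.card_sigma]
    rw [← Finset.sum_coe_sort]
    refine Finset.sum_congr rfl fun c0 _ => ?_
    rw [← hbc]; simp

theorem FChain.ineq {K F K'' F'' : Subfield L} (h : FChain K F K'' F'') :
    ∀ {V E : Set L}, V.Finite → E.Finite → rk K V * rk F'' E ≤ rk K'' V * rk F (V * E) := by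
  induction h with
  | refl K F =>
    intro V E hV hE
    by_cases hz : ∃ v ∈ V, v ≠ 0
    · obtain ⟨v, hv, hv0⟩ := hz
      refine Nat.mul_le_mul_left _ ?_
      rw [← rk_mul_left v hv0 E]
      refine rk_mono (hV.mul hE) ?_
      rintro _ ⟨e, he, rfl⟩
      exact Set.mul_mem_mul hv he
    · push Not at hz
      have : rk K V = 0 := by
        have h1 : Submodule.span K V = ⊥ := Submodule.span_eq_bot.2 hz
        rw [rk, Set.finrank, h1]; simp
      rw [this]; simp
  | @step K F K' F' K'' F'' τ h hc ih =>
    intro V E hV hE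
    obtain ⟨O, U, h1, h2, h3⟩ := h.exists_split hV
    calc rk K V * rk F'' E ≤ (∑ c ∈ O, rk K' (U c : Set L)) * rk F'' E :=
          Nat.mul_le_mul_right _ h1
      _ = ∑ c ∈ O, rk K' (U c : Set L) * rk F'' E := Finset.sum_mul _ _ _
      _ ≤ ∑ c ∈ O, rk K'' (U c : Set L) * rk F' ((U c : Set L) * E) :=
          Finset.sum_le_sum fun c _ => ih (U c).finite_toSet hE
      _ ≤ ∑ c ∈ O, rk K'' V * rk F' ((U c : Set L) * E) := by
          refine Finset.sum_le_sum fun c hc' => Nat.mul_le_mul_right _ ?_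
          exact rk_le_of_subset_span hV fun x hx => span_mono_field hc.leK (h2 c hc' hx)
      _ = rk K'' V * ∑ c ∈ O, rk F' ((U c : Set L) * E) := (Finset.mul_sum _ _ _).symm
      _ ≤ _ := Nat.mul_le_mul_left _ (h3 E hE)

end chain
end ConvexPaper

namespace ConvexPaper

section mv
open MvPolynomial
variable {L : Type*} [Field L] {σ : Type*} [Fintype σ]

theorem mv_coeff_mul_C (n : σ →₀ ℕ) (f : MvPolynomial σ L) (x : L) :
    coeff n (f * C x) = coeff n f * x := by
  rw [mul_comm, coeff_C_mul, mul_comm]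

theorem mv_coords {K : Subfield L} {b : Finset L} (f : MvPolynomial σ L)
    (hf : ∀ n, coeff n f ∈ Submodule.span K (b : Set L)) :
    ∃ a : b → MvPolynomial σ K, f = ∑ v, map K.subtype (a v) * C (v : L) := by
  classical
  choose κ hκ using fun n => mem_span_finset_exists (hf n)
  refine ⟨fun v => ∑ n ∈ f.support, monomial n (κ n v), ?_⟩
  ext n
  simp only [coeff_sum, mv_coeff_mul_C, coeff_map, coeff_monomial]
  by_cases hn : n ∈ f.support
  · rw [hκ n]
    refine Finset.sum_congr rfl fun v _ => ?_
    simp [Finset.sum_ite_eq', mem_support_iff.1 hn]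
  · simp [notMem_support_iff.1 hn]

theorem dep_mv {K : Subfield L} {b : Finset L} {ι : Type*} [Fintype ι] (f : ι → MvPolynomial σ L)
    (hf : ∀ i n, coeff n (f i) ∈ Submodule.span K (b : Set L)) (h : b.card < Fintype.card ι) :
    ∃ P : ι → MvPolynomial σ K, (∃ i, P i ≠ 0) ∧ ∑ i, map K.subtype (P i) * f i = 0 := by
  choose a ha using fun i => mv_coords (f i) (hf i)
  obtain ⟨P, hP, hPa⟩ := exists_dep a (by simpa using h)
  refine ⟨P, hP, ?_⟩
  calc ∑ i, map K.subtype (P i) * f i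
      = ∑ i, ∑ v, map K.subtype (P i * a i v) * C (v : L) := by
        refine Finset.sum_congr rfl fun i _ => ?_
        rw [ha i, Finset.mul_sum]
        exact Finset.sum_congr rfl fun v _ => by simp [mul_assoc]
    _ = ∑ v, map K.subtype (∑ i, P i * a i v) * C (v : L) := by
        rw [Finset.sum_comm]
        refine Finset.sum_congr rfl fun v _ => ?_
        rw [map_sum, Finset.sum_mul]
    _ = 0 := Finset.sum_eq_zero fun v _ => by rw [hPa v]; simp

theorem mv_indep {K : Subfield L} {ι : Type*} [Fintype ι] {y : ι → L}
    (hli : LinearIndependent K y) (P : ι → MvPolynomial σ K)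
    (hP : ∑ v, map K.subtype (P v) * C (y v) = 0) : ∀ v, P v = 0 := by
  intro v
  ext n
  have := congrArg (fun F : MvPolynomial σ L => coeff n F) hP
  simp only [coeff_sum, mv_coeff_mul_C, coeff_map, coeff_zero] at this
  have h2 := Fintype.linearIndependent_iff.1 hli (fun v => coeff n (P v)) this v
  simp [h2]

/-- the generic linear form -/
noncomputable def gform (a : σ → L) : MvPolynomial σ L := ∑ b, C (a b) * X b

theorem coeff_gform_mul [DecidableEq σ] (a : σ → L) (H : MvPolynomial σ L) (e : σ →₀ ℕ) (b : σ) :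
    coeff (e + Finsupp.single b 1) (gform a * H) =
      ∑ b', a b' * (if b' ∈ (e + Finsupp.single b 1).support then
        coeff (e + Finsupp.single b 1 - Finsupp.single b' 1) H else 0) := by
  rw [gform, Finset.sum_mul, coeff_sum]
  refine Finset.sum_congr rfl fun b' _ => ?_
  rw [mul_assoc, coeff_C_mul, coeff_X_mul']

theorem gform_ne_zero {a : σ → L} {b : σ} (hb : a b ≠ 0) : gform a ≠ 0 := by
  classical
  intro h
  have := coeff_gform_mul a 1 0 b
  rw [mul_one, h] at this
  simp only [coeff_zero, zero_add] at this
  rw [Finset.sum_eq_single b] at this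
  · simp at this
    exact hb this.symm
  · intro b' _ hne
    rw [if_neg, mul_zero]
    simpa using hne
  · simp

/-- (A1) -/
theorem rk_add_le {K K' : Subfield L} {ζ a : σ → L}
    (htr : ∀ p : MvPolynomial σ K, eval ζ (map K.subtype p) = 0 → p = 0)
    (hK' : ∀ p : MvPolynomial σ K, eval ζ (map K.subtype p) ∈ K')
    (hζ : ∑ b, a b * ζ b = 0) {b0 : σ} (hb0 : a b0 ≠ 0)
    {U W : Set L} (hU : U.Finite) (hW : W.Finite) (hUW : ∀ b, ∀ u ∈ U, a b * u ∈ W) :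
    rk K U + rk K' W ≤ rk K W := by
  obtain ⟨b1, hbs1, hbc1, hli1, hsp1⟩ := exists_basis_subset K U hU
  obtain ⟨b2, hbs2, hbc2, hli2, hsp2⟩ := exists_basis_subset K' W hW
  obtain ⟨b3, hbs3, hbc3, hli3, hsp3⟩ := exists_basis_subset K W hW
  by_contra hlt
  push Not at hlt
  rw [← hbc1, ← hbc2, ← hbc3] at hlt
  let f : b1 ⊕ b2 → MvPolynomial σ L :=
    Sum.elim (fun u => gform a * C (u : L)) (fun w => C (w : L))
  obtain ⟨P, ⟨i, hi⟩, hP⟩ := dep_mv (K := K) (b := b3) f (by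
    classical
    rintro (u | w) n
    · simp only [f, Sum.elim_inl, gform, Finset.sum_mul, coeff_sum]
      refine Submodule.sum_mem _ fun b _ => ?_
      rw [mv_coeff_mul_C, coeff_C_mul, coeff_X']
      split_ifs
      · rw [mul_one]; exact hsp3 (hUW b u (hbs1 u.2))
      · simp
    · simp only [f, Sum.elim_inr]
      rw [coeff_C]
      split_ifs
      · exact hsp3 (hbs2 w.2)
      · simp) (by simpa using hlt)
  rw [Fintype.sum_sum_type] at hP
  simp only [f, Sum.elim_inl, Sum.elim_inr] at hP
  have hgz : eval ζ (gform a) = 0 := by simp [gform, hζ]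
  have h2 : ∀ w, P (Sum.inr w) = 0 := by
    have h3 := congrArg (eval ζ) hP
    rw [map_add, map_sum, map_sum] at h3
    simp only [map_mul, hgz, zero_mul, mul_zero, Finset.sum_const_zero, zero_add, map_zero,
      eval_C] at h3
    intro w
    apply htr
    have := Fintype.linearIndependent_iff.1 hli2
      (fun w => ⟨eval ζ (map K.subtype (P (Sum.inr w))), hK' _⟩) h3 w
    exact congrArg Subtype.val this
  have h1 : ∀ u, P (Sum.inl u) = 0 := by
    refine mv_indep hli1 _ ?_
    simp only [h2, map_zero, zero_mul, Finset.sum_const_zero, add_zero] at hP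
    have h4 : gform a * ∑ v : b1, map K.subtype (P (Sum.inl v)) * C (v : L) = 0 := by
      rw [← hP, Finset.mul_sum]
      exact Finset.sum_congr rfl fun v _ => by ring
    exact (mul_eq_zero.1 h4).resolve_left (gform_ne_zero hb0)
  rcases i with u | w
  · exact hi (h1 u)
  · exact hi (h2 w)

/-- Powers of a set, span version -/
theorem pow_span_mul_mem {K : Subfield L} {A C' : Set L} {n : ℕ} {x c : L}
    (hx : x ∈ A) (hc : c ∈ Submodule.span K (A ^ n * C')) :
    x * c ∈ Submodule.span K (A ^ (n + 1) * C') := by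
  refine Submodule.span_induction (p := fun c _ => x * c ∈ Submodule.span K (A ^ (n + 1) * C'))
    ?_ ?_ ?_ ?_ hc
  · rintro _ ⟨p, hp, q, hq, rfl⟩
    refine Submodule.subset_span ⟨x * p, ?_, q, hq, by simp only; ring⟩
    rw [pow_succ']
    exact Set.mul_mem_mul hx hp
  · simp
  · intro y z _ _ hy hz; rw [mul_add]; exact Submodule.add_mem _ hy hz
  · intro k y _ hy; rw [mul_smul_comm]; exact Submodule.smul_mem _ k hy

theorem pow_mem_span_mul {K : Subfield L} {A C' : Set L} {n m : ℕ} {x c : L}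
    (hx : x ∈ A ^ m) (hc : c ∈ Submodule.span K (A ^ n * C')) :
    x * c ∈ Submodule.span K (A ^ (n + m) * C') := by
  induction m generalizing x with
  | zero =>
    rw [pow_zero, Set.mem_one] at hx
    rw [hx]; simpa using hc
  | succ m ih =>
    rw [pow_succ'] at hx
    obtain ⟨y, hy, z, hz, rfl⟩ := hx
    have := pow_span_mul_mem hy (ih hz)
    rw [← add_assoc]
    simpa [mul_assoc] using this

/-- Dedekind–Mertens, one variable at a time. -/
theorem dm_aux {K : Subfield L} (a : σ → L) (H : MvPolynomial σ L) (Y : Set L)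
    (hY : ∀ n, coeff n (gform a * H) ∈ Submodule.span K Y) {D : ℕ} (hD : H.totalDegree ≤ D)
    (b : σ) : ∀ m, ∀ e : σ →₀ ℕ, D < e b + m →
      (m = 0 → coeff e H = 0) ∧
      (∀ m', m = m' + 1 → a b ^ m * coeff e H ∈ Submodule.span K ((Set.range a) ^ m' * Y)) := by
  classical
  intro m
  induction m with
  | zero =>
    intro e he
    refine ⟨fun _ => ?_, fun m' h => by omega⟩
    apply coeff_eq_zero_of_totalDegree_lt
    refine lt_of_le_of_lt hD (lt_of_lt_of_le he ?_)
    simp only [add_zero]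
    by_cases hb : e b = 0
    · rw [hb]; exact Nat.zero_le _
    · exact Finset.single_le_sum (f := fun i => e i) (fun _ _ => Nat.zero_le _)
        (Finsupp.mem_support_iff.2 hb)
  | succ m ih =>
    intro e he
    refine ⟨fun h => by omega, fun m' h => ?_⟩
    obtain rfl : m = m' := by omega
    have h1 := coeff_gform_mul a H e b
    rw [← Finset.add_sum_erase _ _ (Finset.mem_univ b)] at h1
    have h2 : coeff e H * a b = coeff (e + Finsupp.single b 1) (gform a * H) -
        ∑ b' ∈ Finset.univ.erase b, a b' * (if b' ∈ (e + Finsupp.single b 1).support then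
        coeff (e + Finsupp.single b 1 - Finsupp.single b' 1) H else 0) := by
      rw [h1, if_pos (by simp), add_tsub_cancel_right e (Finsupp.single b 1)]
      ring
    rw [pow_succ, mul_assoc, mul_comm (a b), h2, mul_sub, Finset.mul_sum]
    refine Submodule.sub_mem _ ?_ (Submodule.sum_mem _ fun b' hb' => ?_)
    · have : coeff (e + Finsupp.single b 1) (gform a * H) ∈
          Submodule.span K ((Set.range a) ^ 0 * Y) := by simpa using hY _
      have h3 := pow_mem_span_mul (m := m) (x := a b ^ m)
        (Set.pow_mem_pow (Set.mem_range_self b)) this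
      simpa using h3
    · split_ifs with hs
      · have hne : b' ≠ b := (Finset.mem_erase.1 hb').1
        have hdeg : D < (e + Finsupp.single b 1 - Finsupp.single b' 1 : σ →₀ ℕ) b + m := by
          simp [Finsupp.single_apply, hne]
          omega
        obtain ⟨i0, i1⟩ := ih _ hdeg
        rcases Nat.eq_zero_or_pos m with hm | hm
        · rw [i0 hm]; simp
        · obtain ⟨m', rfl⟩ : ∃ m', m = m' + 1 := ⟨m - 1, by omega⟩
          have := pow_span_mul_mem (Set.mem_range_self b') (i1 m' rfl)
          convert this using 1
          ring
      · simp

theorem dm {K : Subfield L} (a : σ → L) (H : MvPolynomial σ L) (Y : Set L)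
    (hY : ∀ n, coeff n (gform a * H) ∈ Submodule.span K Y) :
    ∃ N, ∀ e, ∀ x ∈ (Set.range a) ^ (N + 1), x * coeff e H ∈
      Submodule.span K ((Set.range a) ^ N * Y) := by
  classical
  set D := H.totalDegree with hD
  refine ⟨Fintype.card σ * D, fun e x hx => ?_⟩
  rw [Set.mem_pow] at hx
  obtain ⟨f, hf⟩ := hx
  have : ∀ i, ∃ b, a b = f i := fun i => (f i).2
  choose φ hφ using this
  obtain ⟨b, hb⟩ : ∃ b, D < (Finset.univ.filter fun i => φ i = b).card := by
    by_contra hno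
    push Not at hno
    have h1 := Finset.card_eq_sum_card_fiberwise (f := φ) (s := Finset.univ)
      (t := Finset.univ) (fun _ _ => by simp)
    have h2 : ∑ b, (Finset.univ.filter fun i => φ i = b).card ≤ ∑ b : σ, D :=
      Finset.sum_le_sum fun b _ => hno b
    simp at h1 h2
    omega
  obtain ⟨t, ht, htc⟩ := Finset.exists_subset_card_eq (n := D + 1) hb
  have hprod : x = (∏ i ∈ tᶜ, (f i : L)) * a b ^ (D + 1) := by
    rw [← hf, List.prod_ofFn, ← Finset.prod_compl_mul_prod t]
    congr 1
    rw [← htc]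
    refine Finset.prod_eq_pow_card fun i hi => ?_
    rw [← hφ, (Finset.mem_filter.1 (ht hi)).2]
  have h4 := ((dm_aux a H Y hY le_rfl b) (D + 1) e (by omega)).2 D rfl
  have h5 : (∏ i ∈ tᶜ, (f i : L)) ∈ (Set.range a) ^ (tᶜ).card := by
    rw [← Finset.prod_const]
    exact Set.finsetProd_mem_finsetProd _ _ _ fun i _ => (f i).2
  have h6 := pow_mem_span_mul h5 h4
  rw [hprod, mul_assoc]
  have h7 : D + (tᶜ).card = Fintype.card σ * D := by
    rw [Finset.card_compl, htc]
    simp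
    have h1 : t.card ≤ _ := Finset.card_le_univ t
    rw [htc] at h1
    simp at h1
    omega
  rw [h7] at h6
  exact h6

end mv
end ConvexPaper

namespace ConvexPaper

section col
open MvPolynomial
variable {L : Type*} [Field L] {ι : Type*}

/-- Products of elements of the sets `A i`. -/
def Mon (A : ι → Set L) (R : Multiset ι) : Set L := (R.map A).prod

theorem Mon_zero (A : ι → Set L) : Mon A 0 = 1 := by simp [Mon]

theorem Mon_add (A : ι → Set L) (R Q : Multiset ι) : Mon A (R + Q) = Mon A R * Mon A Q := by
  simp [Mon]

theorem Mon_cons (A : ι → Set L) (i : ι) (R : Multiset ι) : Mon A (i ::ₘ R) = A i * Mon A R := by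
  simp [Mon]

theorem Mon_single (A : ι → Set L) (i : ι) : Mon A {i} = A i := by simp [Mon]

theorem Mon_nsmul (A : ι → Set L) (n : ℕ) (i : ι) : Mon A (n • {i}) = A i ^ n := by
  rw [Mon, Multiset.map_nsmul, Multiset.prod_nsmul]; simp

theorem Mon_finite {A : ι → Set L} (hA : ∀ i, (A i).Finite) (R : Multiset ι) :
    (Mon A R).Finite := by
  induction R using Multiset.induction with
  | empty => rw [Mon_zero]; exact Set.finite_one
  | cons i R ih => rw [Mon_cons]; exact (hA i).mul ih

theorem Mon_nonzero {A : ι → Set L} (hA : ∀ i, ∀ x ∈ A i, x ≠ 0) (R : Multiset ι) :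
    ∀ x ∈ Mon A R, x ≠ 0 := by
  induction R using Multiset.induction with
  | empty => rw [Mon_zero]; intro x hx; rw [Set.mem_one.1 hx]; exact one_ne_zero
  | cons i R ih =>
    rw [Mon_cons]
    rintro _ ⟨x, hx, y, hy, rfl⟩
    exact mul_ne_zero (hA i x hx) (ih y hy)

theorem Mon_nonempty {A : ι → Set L} (hA : ∀ i, (A i).Nonempty) (R : Multiset ι) :
    (Mon A R).Nonempty := by
  induction R using Multiset.induction with
  | empty => rw [Mon_zero]; exact Set.one_nonempty
  | cons i R ih => rw [Mon_cons]; exact (hA i).mul ih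

theorem Mon_subset {A : ι → Set L} {M : Subfield L} (hA : ∀ i, A i ⊆ M) (R : Multiset ι) :
    Mon A R ⊆ M := by
  induction R using Multiset.induction with
  | empty => rw [Mon_zero]; intro x hx; rw [Set.mem_one.1 hx]; exact M.one_mem
  | cons i R ih =>
    rw [Mon_cons]
    rintro _ ⟨x, hx, y, hy, rfl⟩
    exact M.mul_mem (hA i hx) (ih hy)

/-- colon condition with given witness -/
def ColW (A : ι → Set L) (K : Subfield L) (R Q c : Multiset ι) (h : L) : Prop :=
  ∀ a ∈ Mon A (Q + c), h * a ∈ Submodule.span K (Mon A (R + c))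

/-- colon spaces -/
def Col (A : ι → Set L) (K : Subfield L) (R Q : Multiset ι) (h : L) : Prop :=
  ∃ c, ColW A K R Q c h

theorem ColW.add {A : ι → Set L} {K : Subfield L} {R Q c : Multiset ι} {h : L}
    (H : ColW A K R Q c h) (c' : Multiset ι) : ColW A K R Q (c + c') h := by
  intro a ha
  rw [← add_assoc, Mon_add] at ha
  obtain ⟨x, hx, y, hy, rfl⟩ := ha
  rw [← add_assoc, Mon_add]
  simp only
  rw [← mul_assoc]
  exact span_mul_mem (H x hx) hy

theorem Col.common {A : ι → Set L} {K : Subfield L} {R Q : Multiset ι} (b : Finset L)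
    (hb : ∀ x ∈ b, Col A K R Q x) : ∃ c, ∀ x ∈ b, ColW A K R Q c x := by
  classical
  induction b using Finset.induction_on with
  | empty => exact ⟨0, by simp⟩
  | insert x b hx ih =>
    obtain ⟨c, hc⟩ := ih fun y hy => hb y (Finset.mem_insert_of_mem hy)
    obtain ⟨c', hc'⟩ := hb x (Finset.mem_insert_self _ _)
    refine ⟨c + c', fun y hy => ?_⟩
    rcases Finset.mem_insert.1 hy with rfl | hy
    · rw [add_comm]; exact hc'.add c
    · exact (hc y hy).add c'

theorem Col.mono {A : ι → Set L} {K K' : Subfield L} (hK : K ≤ K') {R Q : Multiset ι} {h : L}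
    (H : Col A K R Q h) : Col A K' R Q h := by
  obtain ⟨c, hc⟩ := H
  exact ⟨c, fun a ha => span_mono_field hK (hc a ha)⟩

theorem Col.of_mem {A : ι → Set L} {K : Subfield L} {R : Multiset ι} {h : L}
    (H : h ∈ Mon A R) : Col A K R 0 h := by
  refine ⟨0, fun a ha => ?_⟩
  simp only [add_zero, Mon_zero] at ha ⊢
  rw [Set.mem_one.1 ha, mul_one]
  exact Submodule.subset_span H

/-- shift: `Col (R+e, e) = Col (R,0)` -/
theorem Col.shift {A : ι → Set L} {K : Subfield L} {R : Multiset ι} {i : ι} {h : L}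
    (H : Col A K (i ::ₘ R) {i} h) : Col A K R 0 h := by
  obtain ⟨c, hc⟩ := H
  refine ⟨i ::ₘ c, fun a ha => ?_⟩
  have h1 := hc a (by
    rw [zero_add] at ha
    rwa [Multiset.singleton_add])
  rw [Multiset.cons_add] at h1
  rw [Multiset.add_cons]
  exact h1

theorem Col.mul {A : ι → Set L} {K : Subfield L} {R Q P : Multiset ι} {h a : L}
    (H : Col A K R Q h) (ha : a ∈ Mon A P) : Col A K (P + R) Q (a * h) := by
  obtain ⟨c, hc⟩ := H
  refine ⟨c, fun x hx => ?_⟩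
  have := span_mul_mem (hc x hx) ha
  rw [← Mon_add, add_comm, ← add_assoc] at this
  convert this using 1
  ring

/-- Upper bound for the rank of `Col`. -/
def UB (A : ι → Set L) (K : Subfield L) (R Q : Multiset ι) (d : ℕ) : Prop :=
  ∀ b : Finset L, (∀ x ∈ b, Col A K R Q x) → LinearIndependent K (fun v : b => (v : L)) →
    b.card ≤ d

theorem mem_of_span {K M : Subfield L} (hKM : K ≤ M) {s : Set L} (hs : s ⊆ M) {x : L}
    (hx : x ∈ Submodule.span K s) : x ∈ M := by
  refine Submodule.span_induction (p := fun x _ => x ∈ M) ?_ ?_ ?_ ?_ hx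
  · intro x hx; exact hs hx
  · exact M.zero_mem
  · intro x y _ _ hx hy; exact M.add_mem hx hy
  · intro a x _ hx; exact M.mul_mem (hKM a.2) hx

theorem Col.mem {A : ι → Set L} {K M : Subfield L} (hKM : K ≤ M) (hA : ∀ i, A i ⊆ M)
    (hne : ∀ i, (A i).Nonempty) (h0 : ∀ i, ∀ x ∈ A i, x ≠ 0)
    {R Q : Multiset ι} {h : L} (H : Col A K R Q h) : h ∈ M := by
  obtain ⟨c, hc⟩ := H
  obtain ⟨a, ha⟩ := Mon_nonempty hne (Q + c)
  have h1 := mem_of_span hKM (Mon_subset hA _) (hc a ha)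
  have ha0 := Mon_nonzero h0 _ a ha
  have : h = h * a * a⁻¹ := by field_simp
  rw [this]
  exact M.mul_mem h1 (M.inv_mem (Mon_subset hA _ ha))

theorem Col.algebraic {A : ι → Set L} {K : Subfield L} (hfin : ∀ i, (A i).Finite)
    (hne : ∀ i, (A i).Nonempty) (h0 : ∀ i, ∀ x ∈ A i, x ≠ 0) {i : ι} {h : L} (hh : h ≠ 0)
    (H : Col A K 0 {i} h) {a a' : L} (ha : a ∈ A i) (ha' : a' ∈ A i) :
    IsAlgebraic K (a' / a) := by
  obtain ⟨c, hc⟩ := H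
  have key : ∀ x ∈ A i, IsAlgebraic K (h * x) := by
    intro x hx
    apply IsIntegral.isAlgebraic
    obtain ⟨m, hm⟩ := Mon_nonempty hne c
    refine isIntegral_of_smul_mem_submodule (M := L) (Submodule.span K (Mon A c)) ?_ ?_ _ ?_
    · intro hbot
      have : m ∈ Submodule.span K (Mon A c) := Submodule.subset_span hm
      rw [hbot, Submodule.mem_bot] at this
      exact Mon_nonzero h0 _ m hm this
    · exact Submodule.fg_span (Mon_finite hfin c)
    · intro n hn
      refine Submodule.span_induction
        (p := fun n _ => (h * x) • n ∈ Submodule.span K (Mon A c)) ?_ ?_ ?_ ?_ hn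
      · intro y hy
        have := hc (x * y) (by rw [Mon_add, Mon_single]; exact Set.mul_mem_mul hx hy)
        rw [zero_add] at this
        rw [smul_eq_mul, mul_assoc]; exact this
      · simp
      · intro y z _ _ hy hz; rw [smul_add]; exact Submodule.add_mem _ hy hz
      · intro k y _ hy
        rw [smul_comm]; exact Submodule.smul_mem _ k hy
  have : a' / a = (h * a') * (h * a)⁻¹ := by
    have := h0 i a ha
    field_simp
  rw [this]
  exact (key a' ha').mul (key a ha).inv

theorem mv_common_denom {σ : Type*} {K K' : Subfield L} {ζ : σ → L}
    (hfr : ∀ y ∈ K', ∃ p q : MvPolynomial σ K, eval ζ (map K.subtype q) ≠ 0 ∧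
      eval ζ (map K.subtype q) * y = eval ζ (map K.subtype p))
    {ι : Type*} [Fintype ι] (κ : ι → L) (hκ : ∀ i, κ i ∈ K') :
    ∃ (q : MvPolynomial σ K) (p : ι → MvPolynomial σ K), eval ζ (map K.subtype q) ≠ 0 ∧
      ∀ i, eval ζ (map K.subtype q) * κ i = eval ζ (map K.subtype (p i)) := by
  classical
  choose p q hq hpq using fun i => hfr (κ i) (hκ i)
  refine ⟨∏ i, q i, fun i => (∏ j ∈ Finset.univ.erase i, q j) * p i, ?_, ?_⟩
  · rw [map_prod, map_prod]
    exact Finset.prod_ne_zero_iff.2 fun i _ => hq i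
  · intro i
    rw [← Finset.mul_prod_erase _ _ (Finset.mem_univ i)]
    simp only [map_mul, ← hpq]
    ring

/-- Coefficients of the quotient by the linear form lie in a colon space. -/
theorem Col.of_dm {σ : Type*} [Fintype σ] {A : ι → Set L} {K : Subfield L} {i : ι} {a : σ → L}
    (haA : Set.range a = A i) {R : Multiset ι} (Y : Finset L) (hY : ∀ y ∈ Y, Col A K R 0 y)
    (H : MvPolynomial σ L)
    (hH : ∀ n, coeff n (gform a * H) ∈ Submodule.span K (Y : Set L)) (e : σ →₀ ℕ) :
    Col A K R {i} (coeff e H) := by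
  obtain ⟨N, hN⟩ := dm a H Y hH
  obtain ⟨c, hc⟩ := Col.common Y hY
  refine ⟨N • {i} + c, fun m hm => ?_⟩
  rw [← add_assoc, ← succ_nsmul', Mon_add, Mon_nsmul, ← haA] at hm
  obtain ⟨x, hx, y, hy, rfl⟩ := hm
  have h1 := hN e x hx
  simp only
  rw [← mul_assoc, mul_comm (coeff e H)]
  refine Submodule.span_induction
    (p := fun z _ => z * y ∈ Submodule.span K (Mon A (R + (N • {i} + c)))) ?_ ?_ ?_ ?_ h1
  · rintro _ ⟨p, hp, q, hq, rfl⟩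
    have h2 := hc q hq y (by rwa [zero_add])
    have h3 := span_mul_mem h2 hp
    rw [haA, ← Mon_nsmul, ← Mon_add] at h3
    have h4 : R + c + N • {i} = R + (N • {i} + c) := by abel
    rw [h4] at h3
    convert h3 using 1
    ring
  · simp
  · intro u v _ _ hu hv; rw [add_mul]; exact Submodule.add_mem _ hu hv
  · intro k u _ hu; rw [smul_mul_assoc]; exact Submodule.smul_mem _ k hu

/-- (A2) -/
theorem UB_add {σ : Type*} [Fintype σ] {A : ι → Set L} {K K' M : Subfield L} {i : ι}
    {ζ a : σ → L} (haA : Set.range a = A i) (hKK' : K ≤ K') (hKM : K ≤ M) (hA : ∀ i, A i ⊆ M)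
    (hne : ∀ i, (A i).Nonempty) (h0 : ∀ i, ∀ x ∈ A i, x ≠ 0)
    (hfr : ∀ y ∈ K', ∃ p q : MvPolynomial σ K, eval ζ (map K.subtype q) ≠ 0 ∧
      eval ζ (map K.subtype q) * y = eval ζ (map K.subtype p))
    (hker : ∀ H : MvPolynomial σ L, (∀ n, coeff n H ∈ M) → eval ζ H = 0 → gform a ∣ H)
    {R : Multiset ι} {d1 d2 : ℕ} (h1 : UB A K R {i} d1) (h2 : UB A K' R 0 d2) :
    UB A K R 0 (d1 + d2) := by
  classical
  intro Y hY hYli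
  obtain ⟨b', hbs, hbc, hli, hsp⟩ := exists_basis_subset K' (Y : Set L) Y.finite_toSet
  have hb'Y : b' ⊆ Y := by exact_mod_cast hbs
  have hb'c : b'.card ≤ d2 := h2 b' (fun x hx => (hY x (hb'Y hx)).mono hKK') hli
  set J := Y \ b' with hJ
  have hcard : Y.card = J.card + b'.card := by
    rw [hJ, Finset.card_sdiff_add_card_eq_card hb'Y]
  suffices hJc : J.card ≤ d1 by omega
  have hrel : ∀ j : J, ∃ (q : MvPolynomial σ K) (p : b' → MvPolynomial σ K), q ≠ 0 ∧
      gform a ∣ map K.subtype q * C (j : L) - ∑ v, map K.subtype (p v) * C (v : L) := by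
    intro j
    have hjY : (j : L) ∈ Y := (Finset.mem_sdiff.1 j.2).1
    obtain ⟨κ, hκ⟩ := mem_span_finset_exists (hsp hjY)
    obtain ⟨q, p, hq, hp⟩ := mv_common_denom hfr (fun v => (κ v : L)) (fun v => (κ v).2)
    refine ⟨q, p, ?_, hker _ ?_ ?_⟩
    · rintro rfl; simp at hq
    · intro n
      have hYM : ∀ y ∈ Y, y ∈ M := fun y hy => (hY y hy).mem hKM hA hne h0
      rw [coeff_sub, coeff_sum]
      refine M.sub_mem ?_ (M.sum_mem fun v _ => ?_)
      · rw [mv_coeff_mul_C, coeff_map]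
        exact M.mul_mem (hKM (coeff n q).2) (hYM _ hjY)
      · rw [mv_coeff_mul_C, coeff_map]
        exact M.mul_mem (hKM (coeff n (p v)).2) (hYM _ (hb'Y v.2))
    · rw [map_sub, map_sum]
      simp only [map_mul, eval_C]
      rw [hκ, Finset.mul_sum, sub_eq_zero]
      refine Finset.sum_congr rfl fun v _ => ?_
      rw [← hp]; ring
  choose q p hq hdvd using hrel
  choose H' hH' using hdvd
  have hcoefY : ∀ j n, coeff n (gform a * H' j) ∈ Submodule.span K (Y : Set L) := by
    intro j n
    rw [← hH' j, coeff_sub, coeff_sum]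
    refine Submodule.sub_mem _ ?_ (Submodule.sum_mem _ fun v _ => ?_)
    · rw [mv_coeff_mul_C, coeff_map]
      exact Submodule.smul_mem _ (coeff n (q j)) (Submodule.subset_span (Finset.mem_sdiff.1 j.2).1)
    · rw [mv_coeff_mul_C, coeff_map]
      exact Submodule.smul_mem _ (coeff n (p j v)) (Submodule.subset_span (hb'Y v.2))
  let W : Finset L := Finset.univ.biUnion fun j : J => (H' j).support.image fun n => coeff n (H' j)
  obtain ⟨b3, hbs3, hbc3, hli3, hsp3⟩ := exists_basis_subset K (W : Set L) W.finite_toSet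
  have hb3 : b3.card ≤ d1 := by
    refine h1 b3 (fun x hx => ?_) hli3
    have hx' : x ∈ W := hbs3 hx
    simp only [W, Finset.mem_biUnion, Finset.mem_image] at hx'
    obtain ⟨j, -, n, -, rfl⟩ := hx'
    exact Col.of_dm haA Y hY (H' j) (hcoefY j) n
  by_contra hlt
  push Not at hlt
  obtain ⟨lam, ⟨j0, hj0⟩, hlam⟩ := dep_mv (K := K) (b := b3) H' (by
    intro j n
    by_cases hn : coeff n (H' j) = 0
    · rw [hn]; exact Submodule.zero_mem _
    · refine hsp3 ?_
      simp only [W, Finset.coe_biUnion, Finset.coe_image, Set.mem_iUnion]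
      exact ⟨j, by simp, n, by simpa using hn, rfl⟩) (by simpa using hb3.trans_lt hlt)
  have hsum : ∑ j, map K.subtype (lam j) * (map K.subtype (q j) * C (j : L) -
      ∑ v, map K.subtype (p j v) * C (v : L)) = 0 := by
    have : ∑ j, map K.subtype (lam j) * (gform a * H' j) = 0 := by
      rw [← mul_zero (gform a), ← hlam, Finset.mul_sum]
      exact Finset.sum_congr rfl fun j _ => by ring
    rw [← this]
    exact Finset.sum_congr rfl fun j _ => by rw [hH']
  let y : J ⊕ b' → L := Sum.elim (fun j => (j : L)) (fun v => (v : L))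
  have hyli : LinearIndependent K y := by
    let φ : J ⊕ b' → Y := Sum.elim (fun j => ⟨j, (Finset.mem_sdiff.1 j.2).1⟩)
      (fun v => ⟨v, hb'Y v.2⟩)
    have hφ : Function.Injective φ := by
      rintro (j | v) (j' | v') h
      · simp only [φ, Sum.elim_inl, Subtype.mk.injEq] at h
        rw [Subtype.ext h]
      · simp only [φ, Sum.elim_inl, Sum.elim_inr, Subtype.mk.injEq] at h
        exact absurd (h ▸ v'.2) (Finset.mem_sdiff.1 j.2).2
      · simp only [φ, Sum.elim_inl, Sum.elim_inr, Subtype.mk.injEq] at h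
        exact absurd (h ▸ v.2) (Finset.mem_sdiff.1 j'.2).2
      · simp only [φ, Sum.elim_inr, Subtype.mk.injEq] at h
        rw [Subtype.ext h]
    have := hYli.comp φ hφ
    convert this using 1
    funext z
    rcases z with j | v <;> rfl
  let P : J ⊕ b' → MvPolynomial σ K :=
    Sum.elim (fun j => lam j * q j) (fun v => - ∑ j, lam j * p j v)
  have hP := mv_indep hyli P (by
    rw [← hsum, Fintype.sum_sum_type]
    simp only [P, y, Sum.elim_inl, Sum.elim_inr, map_mul, map_neg, map_sum, mul_sub,
      Finset.sum_sub_distrib, Finset.mul_sum, neg_mul, Finset.sum_neg_distrib, Finset.sum_mul]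
    rw [← sub_eq_add_neg]
    congr 1
    · exact Finset.sum_congr rfl fun j _ => by ring
    · rw [Finset.sum_comm]
      exact Finset.sum_congr rfl fun j _ => Finset.sum_congr rfl fun v _ => by ring)
  have := hP (Sum.inl j0)
  exact mul_ne_zero hj0 (hq j0) this

end col
end ConvexPaper

namespace ConvexPaper

section fields
variable {L : Type*} [Field L]

/-- the field generated over `F` by `s`, as a subfield -/
def jn (F : Type*) [Field F] [Algebra F L] (s : Set L) : Subfield L :=
  (IntermediateField.adjoin F s).toSubfield

variable {F : Type*} [Field F] [Algebra F L]

theorem mem_jn {s : Set L} {x : L} : x ∈ jn F s ↔ x ∈ IntermediateField.adjoin F s := Iff.rfl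

theorem jn_le {s : Set L} {M : Subfield L} :
    jn F s ≤ M ↔ Set.range (algebraMap F L) ⊆ M ∧ s ⊆ M := by
  rw [jn, IntermediateField.adjoin_toSubfield, Subfield.closure_le, Set.union_subset_iff]

theorem subset_jn (s : Set L) : s ⊆ jn F s := (jn_le.1 le_rfl).2

theorem range_subset_jn (s : Set L) : Set.range (algebraMap F L) ⊆ (jn F s : Set L) :=
  (jn_le.1 le_rfl).1

theorem jn_mono {s t : Set L} (h : s ⊆ t) : jn F s ≤ jn F t :=
  jn_le.2 ⟨range_subset_jn _, h.trans (subset_jn _)⟩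

theorem le_jn (K : Subfield L) (s : Set L) : K ≤ jn K s := by
  intro x hx
  exact range_subset_jn s ⟨(⟨x, hx⟩ : K), rfl⟩

theorem jn_jn (s t : Set L) : jn (jn F s) t = jn F (s ∪ t) := by
  apply le_antisymm
  · refine jn_le.2 ⟨?_, Set.subset_union_right.trans (subset_jn _)⟩
    rintro _ ⟨x, rfl⟩
    exact jn_mono Set.subset_union_left x.2
  · refine jn_le.2 ⟨?_, Set.union_subset ?_ (subset_jn _)⟩
    · exact (range_subset_jn s).trans (le_jn _ _)
    · exact (subset_jn s).trans (le_jn _ _)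

theorem jn_AI {ι : Type*} {x : ι → L} (hx : AlgebraicIndependent F x) {s t : Set ι}
    (h : Disjoint s t) : AlgebraicIndependent (jn F (x '' s)) (fun i : t => x i) :=
  IntermediateField.algebraicIndependent_adjoin_iff.2 (hx.adjoin_of_disjoint h)

theorem jn_AI_comp {ι κ : Type*} {x : ι → L} (hx : AlgebraicIndependent F x) {s : Set ι}
    {f : κ → ι} (hf : f.Injective) (h : ∀ k, f k ∉ s) :
    AlgebraicIndependent (jn F (x '' s)) (fun k => x (f k)) := by
  have h1 := jn_AI hx (s := s) (t := sᶜ) disjoint_compl_right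
  exact h1.comp (fun k => (⟨f k, h k⟩ : ↥(sᶜ))) (fun a b hab => hf (by simpa using hab))

theorem jn_transcendental {ι : Type*} {x : ι → L} (hx : AlgebraicIndependent F x) {s : Set ι}
    {i : ι} (h : i ∉ s) : Transcendental (jn F (x '' s)) (x i) :=
  IntermediateField.transcendental_adjoin_iff.2 (hx.transcendental_adjoin h)

theorem aeval_eq_eval_map {σ : Type*} (K : Subfield L) (ζ : σ → L) (p : MvPolynomial σ K) :
    MvPolynomial.aeval ζ p = MvPolynomial.eval ζ (MvPolynomial.map K.subtype p) := by
  rw [MvPolynomial.eval_map]; rfl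

theorem paeval_eq_eval_map (K : Subfield L) (τ : L) (p : Polynomial K) :
    Polynomial.aeval τ p = Polynomial.eval τ (p.map K.subtype) := by
  rw [Polynomial.eval_map]; rfl

theorem AI.htr {σ : Type*} {K : Subfield L} {ζ : σ → L} (h : AlgebraicIndependent K ζ) :
    ∀ p : MvPolynomial σ K, MvPolynomial.eval ζ (MvPolynomial.map K.subtype p) = 0 → p = 0 := by
  intro p hp
  rw [← aeval_eq_eval_map] at hp
  exact algebraicIndependent_iff.1 h p hp

theorem jn_eval {σ : Type*} (K : Subfield L) (ζ : σ → L) (p : MvPolynomial σ K) :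
    MvPolynomial.eval ζ (MvPolynomial.map K.subtype p) ∈ jn K (Set.range ζ) := by
  rw [mem_jn, IntermediateField.mem_adjoin_range_iff]
  exact ⟨p, 1, by simp [aeval_eq_eval_map]⟩

theorem jn_hfr {σ : Type*} (K : Subfield L) (ζ : σ → L) : ∀ y ∈ jn K (Set.range ζ),
    ∃ p q : MvPolynomial σ K, MvPolynomial.eval ζ (MvPolynomial.map K.subtype q) ≠ 0 ∧
      MvPolynomial.eval ζ (MvPolynomial.map K.subtype q) * y =
        MvPolynomial.eval ζ (MvPolynomial.map K.subtype p) := by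
  intro y hy
  rw [mem_jn, IntermediateField.mem_adjoin_range_iff] at hy
  obtain ⟨r, s, rfl⟩ := hy
  simp only [aeval_eq_eval_map]
  by_cases h : MvPolynomial.eval ζ (MvPolynomial.map K.subtype s) = 0
  · exact ⟨0, 1, by simp [h]⟩
  · exact ⟨r, s, h, by field_simp⟩

theorem jn_FStep {K F : Subfield L} (hKF : K ≤ F) {τ : L} (h : Transcendental F τ) :
    FStep K F (jn K {τ}) (jn F {τ}) τ := by
  have ev : ∀ (K : Subfield L) (p : Polynomial K), Polynomial.eval τ (p.map K.subtype) ∈ jn K {τ} := by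
    intro K p
    rw [mem_jn, IntermediateField.mem_adjoin_simple_iff]
    exact ⟨p, 1, by simp [paeval_eq_eval_map]⟩
  refine ⟨hKF, ?_, ev K, ?_, ev F⟩
  · intro p hp
    rw [← paeval_eq_eval_map] at hp
    exact transcendental_iff.1 h p hp
  · intro y hy
    rw [mem_jn, IntermediateField.mem_adjoin_simple_iff] at hy
    obtain ⟨r, s, rfl⟩ := hy
    simp only [paeval_eq_eval_map]
    by_cases h : Polynomial.eval τ (s.map K.subtype) = 0
    · exact ⟨0, 1, by simp [h]⟩
    · exact ⟨r, s, h, by field_simp⟩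

theorem FChain.trans {K F K' F' K'' F'' : Subfield L} (h : FChain K F K' F')
    (h' : FChain K' F' K'' F'') : FChain K F K'' F'' := by
  induction h with
  | refl => exact h'
  | step τ h _ ih => exact FChain.step τ h (ih h')

theorem jn_mono_field {K F : Subfield L} (h : K ≤ F) (s : Set L) : jn K s ≤ jn F s := by
  refine jn_le.2 ⟨?_, subset_jn _⟩
  rintro _ ⟨x, rfl⟩
  exact le_jn F s (h x.2)

theorem jn_FChain {K F : Subfield L} (hKF : K ≤ F) {σ : Type*} [Finite σ] {ζ : σ → L}
    (h : AlgebraicIndependent F ζ) :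
    FChain K F (jn K (Set.range ζ)) (jn F (Set.range ζ)) := by
  classical
  cases nonempty_fintype σ
  have key : ∀ s : Finset σ, FChain K F (jn K (ζ '' s)) (jn F (ζ '' s)) := by
    intro s
    induction s using Finset.induction_on with
    | empty =>
      have : ∀ K : Subfield L, jn K (∅ : Set L) = K := fun K =>
        le_antisymm (jn_le.2 ⟨by rintro _ ⟨x, rfl⟩; exact x.2, by simp⟩) (le_jn _ _)
      simp only [Finset.coe_empty, Set.image_empty, this]
      exact FChain.refl _ _
    | insert b s hb ih =>
      refine ih.trans ?_
      have h1 := jn_FStep (jn_mono_field hKF (ζ '' s))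
        (jn_transcendental h (s := (s : Set σ)) (i := b) (by simpa using hb))
      rw [jn_jn, jn_jn] at h1
      have e : ζ '' ↑s ∪ {ζ b} = ζ '' ↑(insert b s) := by
        rw [Finset.coe_insert, Set.image_insert_eq, Set.insert_eq, Set.union_comm]
      rw [e] at h1
      exact FChain.step _ h1 (FChain.refl _ _)
  simpa using key Finset.univ

end fields
end ConvexPaper

namespace ConvexPaper

section kernel
open MvPolynomial
variable {L : Type*} [Field L]

theorem kernel_gen {σ : Type*} [Fintype σ] {M : Subfield L} (a : σ → M) {β : σ}
    (hβ : a β ≠ 0) {s : σ → L} (hs : AlgebraicIndependent M s) {ζ : σ → L}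
    (hζ : ∀ b, b ≠ β → ζ b = s b) (hsum : ∑ b, (a b : L) * ζ b = 0) (H : MvPolynomial σ L)
    (hH : ∀ n, coeff n H ∈ M) (h0 : eval ζ H = 0) : gform (fun b => (a b : L)) ∣ H := by
  classical
  obtain ⟨P, rfl⟩ : H ∈ Set.range (map (σ := σ) M.subtype) := by
    rw [mem_range_map_iff_coeffs_subset]
    intro x hx
    rw [Finset.mem_coe, mem_coeffs_iff] at hx
    obtain ⟨n, -, rfl⟩ := hx
    exact ⟨⟨_, hH n⟩, rfl⟩
  have hg : gform (fun b => (a b : L)) = map M.subtype (gform a) := by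
    simp [gform]
  rw [hg]
  apply map_dvd
  let f : σ → MvPolynomial σ M := fun b =>
    if b = β then -∑ b' ∈ Finset.univ.erase β, C (a b' / a β) * X b' else X b
  let φ : MvPolynomial σ M →ₐ[M] MvPolynomial σ M := aeval f
  have h1 : (Ideal.Quotient.mkₐ M (Ideal.span {gform a})).comp φ =
      Ideal.Quotient.mkₐ M (Ideal.span {gform a}) := by
    apply MvPolynomial.algHom_ext
    intro b
    simp only [AlgHom.comp_apply, Ideal.Quotient.mkₐ_eq_mk, φ, aeval_X, f]
    rw [Ideal.Quotient.eq, Ideal.mem_span_singleton]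
    split_ifs with hb
    · subst hb
      refine ⟨-C (a b)⁻¹, ?_⟩
      rw [gform, ← Finset.add_sum_erase _ _ (Finset.mem_univ b), add_mul, Finset.sum_mul]
      have e1 : C (a b) * X b * -C (a b)⁻¹ = - (X b : MvPolynomial σ M) := by
        have : (C (a b) * C (a b)⁻¹ : MvPolynomial σ M) = 1 := by
          rw [← C_mul, mul_inv_cancel₀ hβ, C_1]
        linear_combination (-X b) * this
      rw [e1, sub_eq_add_neg, add_comm]
      congr 1
      rw [← Finset.sum_neg_distrib]
      refine Finset.sum_congr rfl fun b' _ => ?_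
      rw [div_eq_mul_inv, C_mul]; ring
    · simp
  have h2 : gform a ∣ φ P - P := by
    rw [← Ideal.mem_span_singleton, ← Ideal.Quotient.eq]
    exact DFunLike.congr_fun h1 P
  have h3 : (aeval s).comp φ = aeval (R := M) ζ := by
    apply MvPolynomial.algHom_ext
    intro b
    simp only [AlgHom.comp_apply, φ, aeval_X, f]
    split_ifs with hb
    · subst hb
      rw [← Finset.add_sum_erase _ _ (Finset.mem_univ b)] at hsum
      have hb' : (a b : L) ≠ 0 := by simpa using hβ
      rw [map_neg, map_sum]
      simp only [map_mul, aeval_X, aeval_C]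
      have : ∑ x ∈ Finset.univ.erase b, (algebraMap M L) (a x / a b) * s x =
          (∑ x ∈ Finset.univ.erase b, (a x : L) * ζ x) / a b := by
        rw [Finset.sum_div]
        refine Finset.sum_congr rfl fun x hx => ?_
        rw [hζ x (Finset.ne_of_mem_erase hx), map_div₀]
        change (a x : L) / (a b : L) * s x = _
        ring
      rw [this]
      field_simp
      linear_combination -hsum
    · rw [aeval_X, hζ b hb]
  have h4 : φ P = 0 := by
    apply algebraicIndependent_iff.1 hs
    have := DFunLike.congr_fun h3 P
    rw [AlgHom.comp_apply] at this
    rw [this, aeval_eq_eval_map, h0]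
  rw [h4, zero_sub] at h2
  exact (dvd_neg).1 h2

end kernel

section trdeg
variable {L : Type*} [Field L] {F : Type*} [Field F] [Algebra F L]

theorem card_le_of_isAlgebraic {ι : Type*} {x : ι → L} (hx : AlgebraicIndependent F x)
    (J : Finset ι) (Y : Finset L) (h : ∀ i ∈ J, IsAlgebraic (jn F (Y : Set L)) (x i)) :
    J.card ≤ Y.card := by
  classical
  have h1 : (AlgebraicIndependent.matroid F L).Indep (x '' J) := by
    rw [AlgebraicIndependent.matroid_indep_iff]
    have := (hx.comp (Subtype.val : J → ι) Subtype.val_injective).to_subtype_range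
    have e : Set.range (x ∘ (Subtype.val : J → ι)) = x '' J := by
      rw [Set.range_comp, Subtype.range_coe_subtype]; rfl
    rw [e] at this
    exact this
  have h2 : x '' J ⊆ (AlgebraicIndependent.matroid F L).closure Y := by
    rw [AlgebraicIndependent.matroid_closure_eq]
    rintro _ ⟨i, hi, rfl⟩
    exact IntermediateField.isAlgebraic_adjoin_iff.1 (h i hi)
  have h3 := h1.encard_le_eRk_of_subset h2
  rw [Matroid.eRk_closure_eq] at h3
  have h4 := h3.trans ((AlgebraicIndependent.matroid F L).eRk_le_encard Y)
  rw [hx.injective.encard_image, Set.encard_coe_eq_coe_finsetCard,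
    Set.encard_coe_eq_coe_finsetCard] at h4
  exact_mod_cast h4

end trdeg
end ConvexPaper

namespace ConvexPaper

/-- The algebraic data attached to lattice point sets `S i`. -/
structure Setup (n : ℕ) (ι : Type) (L : Type) [Field L] [Algebra ℚ L] where
  v : Fin n ⊕ ((ι × ℕ) × (Fin n → ℕ)) → L
  hv : AlgebraicIndependent ℚ v
  S : ι → Finset (Fin n → ℕ)
  b0 : ι → Fin n → ℕ
  hb0 : ∀ i, b0 i ∈ S i
  hb1 : ∀ i j, b0 i + Pi.single j 1 ∈ S i

namespace Setup
variable {n : ℕ} {ι : Type} {L : Type} [Field L] [Algebra ℚ L] (D : Setup n ι L)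

noncomputable def xp (b : Fin n → ℕ) : L := ∏ j, D.v (Sum.inl j) ^ b j

theorem v_ne (w) : D.v w ≠ 0 := D.hv.ne_zero w

theorem xp_ne (b : Fin n → ℕ) : D.xp b ≠ 0 :=
  Finset.prod_ne_zero_iff.2 fun _ _ => pow_ne_zero _ (D.v_ne _)

theorem xp_add (b c : Fin n → ℕ) : D.xp (b + c) = D.xp b * D.xp c := by
  simp [xp, pow_add, Finset.prod_mul_distrib]

theorem xp_zero : D.xp 0 = 1 := by simp [xp]

theorem xp_single (j : Fin n) : D.xp (Pi.single j 1) = D.v (Sum.inl j) := by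
  rw [xp, Finset.prod_eq_single j]
  · simp
  · intro b _ hb; simp [Pi.single_eq_of_ne hb]
  · simp

def AA (i : ι) : Set L := D.xp '' (D.S i)

theorem AA_fin (i : ι) : (D.AA i).Finite := (D.S i).finite_toSet.image _

theorem AA_ne (i : ι) : (D.AA i).Nonempty := ⟨_, D.b0 i, D.hb0 i, rfl⟩

theorem AA_0 (i : ι) : ∀ x ∈ D.AA i, x ≠ 0 := by
  rintro _ ⟨b, -, rfl⟩; exact D.xp_ne b

open Classical in
noncomputable def zt (t : ι × ℕ) (b : Fin n → ℕ) : L :=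
  if b = D.b0 t.1 then
    -(∑ b' ∈ (D.S t.1).erase (D.b0 t.1), D.xp b' * D.v (Sum.inr (t, b'))) / D.xp (D.b0 t.1)
  else D.v (Sum.inr (t, b))

theorem zt_of_ne {t : ι × ℕ} {b : Fin n → ℕ} (h : b ≠ D.b0 t.1) :
    D.zt t b = D.v (Sum.inr (t, b)) := by simp [zt, h]

theorem zt_sum (t : ι × ℕ) : ∑ b : D.S t.1, D.xp b * D.zt t b = 0 := by
  classical
  rw [Finset.sum_coe_sort (D.S t.1) (fun b => D.xp b * D.zt t b),
    ← Finset.add_sum_erase _ _ (D.hb0 t.1)]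
  have : ∑ b ∈ (D.S t.1).erase (D.b0 t.1), D.xp b * D.zt t b =
      ∑ b ∈ (D.S t.1).erase (D.b0 t.1), D.xp b * D.v (Sum.inr (t, b)) :=
    Finset.sum_congr rfl fun b hb => by rw [D.zt_of_ne (Finset.ne_of_mem_erase hb)]
  rw [this, zt, if_pos rfl]
  have := D.xp_ne (D.b0 t.1)
  field_simp
  ring

open Classical in
noncomputable def gens (T : Finset (ι × ℕ)) : Finset L :=
  (T.sigma fun t => D.S t.1).image fun p => D.zt p.1 p.2

noncomputable def KT (T : Finset (ι × ℕ)) : Subfield L := jn ℚ (D.gens T : Set L)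

theorem mem_gens {T : Finset (ι × ℕ)} {y : L} :
    y ∈ D.gens T ↔ ∃ t ∈ T, ∃ b ∈ D.S t.1, D.zt t b = y := by
  classical
  simp only [gens, Finset.mem_image, Finset.mem_sigma, Sigma.exists]
  aesop

theorem KT_mono {T T' : Finset (ι × ℕ)} (h : T ⊆ T') : D.KT T ≤ D.KT T' := by
  refine jn_mono fun y hy => ?_
  rw [Finset.mem_coe, mem_gens] at hy ⊢
  obtain ⟨t, ht, r⟩ := hy
  exact ⟨t, h ht, r⟩

theorem KT_insert [DecidableEq ι] (t : ι × ℕ) (T : Finset (ι × ℕ)) :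
    D.KT (insert t T) = jn (D.KT T) (Set.range fun b : D.S t.1 => D.zt t b) := by
  rw [KT, KT, jn_jn]
  congr 1
  ext y
  rw [Finset.mem_coe, mem_gens, Set.mem_union, Finset.mem_coe, mem_gens]
  simp only [Finset.mem_insert, Set.mem_range, Subtype.exists, exists_eq_or_imp]
  rw [or_comm]
  simp

noncomputable def MT (t : ι × ℕ) : Subfield L := jn ℚ (D.v '' {w | ∀ b, w ≠ Sum.inr (t, b)})

theorem v_mem_MT {t : ι × ℕ} {w} (h : ∀ b, w ≠ Sum.inr (t, b)) : D.v w ∈ D.MT t :=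
  subset_jn _ ⟨w, h, rfl⟩

theorem xp_mem_MT (t : ι × ℕ) (b : Fin n → ℕ) : D.xp b ∈ D.MT t :=
  Subfield.prod_mem _ fun j _ => Subfield.pow_mem _ (D.v_mem_MT (by simp)) _

theorem AA_MT (t : ι × ℕ) (i : ι) : D.AA i ⊆ D.MT t := by
  rintro _ ⟨b, -, rfl⟩; exact D.xp_mem_MT t b

theorem KT_le_MT {T : Finset (ι × ℕ)} {t : ι × ℕ} (h : t ∉ T) : D.KT T ≤ D.MT t := by
  classical
  refine jn_le.2 ⟨range_subset_jn _, ?_⟩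
  intro y hy
  rw [Finset.mem_coe, mem_gens] at hy
  obtain ⟨s, hs, b, hb, rfl⟩ := hy
  have hst : s ≠ t := by rintro rfl; exact h hs
  have hv : ∀ b, D.v (Sum.inr (s, b)) ∈ D.MT t := fun b => D.v_mem_MT fun b' h => hst (by
    simp only [Sum.inr.injEq, Prod.mk.injEq] at h; exact h.1)
  rw [SetLike.mem_coe, zt]
  split_ifs
  · exact Subfield.div_mem _ (Subfield.neg_mem _ (Subfield.sum_mem _ fun b' _ =>
      Subfield.mul_mem _ (D.xp_mem_MT _ _) (hv _))) (D.xp_mem_MT _ _)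
  · exact hv _

theorem kernel (t : ι × ℕ) (H : MvPolynomial (D.S t.1) L)
    (hH : ∀ m, MvPolynomial.coeff m H ∈ D.MT t)
    (h0 : MvPolynomial.eval (fun b : D.S t.1 => D.zt t b) H = 0) :
    gform (fun b : D.S t.1 => D.xp b) ∣ H := by
  refine kernel_gen (M := D.MT t) (fun b : D.S t.1 => ⟨D.xp b, D.xp_mem_MT t b⟩)
    (β := ⟨D.b0 t.1, D.hb0 t.1⟩) ?_ (s := fun b => D.v (Sum.inr (t, b))) ?_ ?_ (D.zt_sum t) H hH h0
  · intro h
    exact D.xp_ne _ (congrArg Subtype.val h)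
  · exact jn_AI_comp D.hv (f := fun b : D.S t.1 => Sum.inr (t, (b : Fin n → ℕ)))
      (fun a b h => Subtype.ext (Prod.ext_iff.1 (Sum.inr_injective h)).2) (fun b h => h b rfl)
  · intro b hb
    exact D.zt_of_ne fun h => hb (Subtype.ext h)

theorem range_xp (i : ι) : Set.range (fun b : D.S i => D.xp b) = D.AA i := by
  ext y; simp [AA]

theorem card_le {T : Finset (ι × ℕ)} (h : ∀ j, IsAlgebraic (D.KT T) (D.v (Sum.inl j))) :
    n ≤ T.card := by
  classical
  let f : Fin n ⊕ (Σ _ : ι × ℕ, Fin n → ℕ) → Fin n ⊕ ((ι × ℕ) × (Fin n → ℕ)) :=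
    Sum.map id fun p => (p.1, p.2)
  have hf : f.Injective := by
    refine Function.Injective.sumMap Function.injective_id ?_
    rintro ⟨a, b⟩ ⟨c, d⟩ h
    simp only [Prod.mk.injEq] at h
    rw [h.1, h.2]
  let J := (Finset.univ : Finset (Fin n)).disjSum
    (T.sigma fun t => (D.S t.1).erase (D.b0 t.1))
  have h1 := card_le_of_isAlgebraic (D.hv.comp f hf) J (D.gens T) (by
    rintro (j | ⟨t, b⟩) hi
    · exact h j
    · simp only [J, Finset.inr_mem_disjSum, Finset.mem_sigma, Finset.mem_erase] at hi
      have : D.v (Sum.inr (t, b)) ∈ D.KT T := by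
        apply subset_jn
        rw [Finset.mem_coe, mem_gens]
        exact ⟨t, hi.1, b, hi.2.2, D.zt_of_ne hi.2.1⟩
      exact isAlgebraic_algebraMap (⟨_, this⟩ : D.KT T))
  have h2 : (D.gens T).card ≤ ∑ t ∈ T, (D.S t.1).card := by
    refine Finset.card_image_le.trans ?_
    rw [Finset.card_sigma]
  have h3 : J.card = n + ∑ t ∈ T, ((D.S t.1).card - 1) := by
    simp only [J, Finset.card_disjSum, Finset.card_sigma, Finset.card_univ, Fintype.card_fin]
    congr 1
    exact Finset.sum_congr rfl fun t _ => Finset.card_erase_of_mem (D.hb0 _)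
  have h4 : ∑ t ∈ T, (D.S t.1).card = ∑ t ∈ T, ((D.S t.1).card - 1) + T.card := by
    rw [Finset.card_eq_sum_ones, ← Finset.sum_add_distrib]
    refine Finset.sum_congr rfl fun t _ => ?_
    have := Finset.card_pos.2 ⟨_, D.hb0 t.1⟩
    omega
  omega

/-- for `|T| < n` the colon space `(0 : {i})` vanishes. -/
theorem col_zero {T : Finset (ι × ℕ)} (hT : T.card < n) {i : ι} {h : L}
    (H : Col D.AA (D.KT T) 0 {i} h) : h = 0 := by
  by_contra hh
  refine absurd (D.card_le (T := T) fun j => ?_) (by omega)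
  have := Col.algebraic D.AA_fin D.AA_ne D.AA_0 hh H (a := D.xp (D.b0 i))
    (a' := D.xp (D.b0 i + Pi.single j 1)) ⟨_, D.hb0 i, rfl⟩ ⟨_, D.hb1 i j, rfl⟩
  rwa [xp_add, mul_div_cancel_left₀ _ (D.xp_ne _), xp_single] at this

theorem zt_AI {T : Finset (ι × ℕ)} (hT : T.card < n) {t : ι × ℕ} (ht : t ∉ T) :
    AlgebraicIndependent (D.KT T) (fun b : D.S t.1 => D.zt t b) := by
  classical
  rw [algebraicIndependent_iff]
  intro p hp
  rw [aeval_eq_eval_map] at hp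
  obtain ⟨H, hH⟩ := D.kernel t _ (fun m => by
    rw [MvPolynomial.coeff_map]; exact D.KT_le_MT ht (MvPolynomial.coeff m p).2) hp
  by_contra hp0
  have hH0 : H ≠ 0 := by
    rintro rfl
    rw [mul_zero] at hH
    exact hp0 (MvPolynomial.map_injective _ (D.KT T).subtype.injective (by simpa using hH))
  obtain ⟨e, he⟩ := MvPolynomial.ne_zero_iff.1 hH0
  refine he (D.col_zero hT (i := t.1) ?_)
  refine Col.of_dm (D.range_xp t.1) (R := 0) {1} ?_ H ?_ e
  · intro y hy
    rw [Finset.mem_singleton.1 hy]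
    exact Col.of_mem (by rw [Mon_zero]; exact Set.one_mem_one)
  · intro m
    rw [← hH, MvPolynomial.coeff_map]
    have := Submodule.smul_mem (Submodule.span (D.KT T) (({1} : Finset L) : Set L))
      (MvPolynomial.coeff m p) (Submodule.subset_span (by simp : (1 : L) ∈ _))
    simpa [Subfield.smul_def] using this

/-- dimension function -/
noncomputable def dim (T : Finset (ι × ℕ)) (R : Multiset ι) : ℕ := rk (D.KT T) (Mon D.AA R)

theorem Mon_fin (R : Multiset ι) : (Mon D.AA R).Finite := Mon_finite D.AA_fin R

theorem dim_add_le [DecidableEq ι] {T : Finset (ι × ℕ)} (hT : T.card < n) {t : ι × ℕ}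
    (ht : t ∉ T) (R : Multiset ι) :
    D.dim T R + D.dim (insert t T) (t.1 ::ₘ R) ≤ D.dim T (t.1 ::ₘ R) := by
  refine rk_add_le (AI.htr (D.zt_AI hT ht)) (a := fun b : D.S t.1 => D.xp b) ?_ (D.zt_sum t)
    (b0 := ⟨D.b0 t.1, D.hb0 t.1⟩) (D.xp_ne _) (D.Mon_fin _) (D.Mon_fin _) ?_
  · rw [KT_insert]
    exact jn_eval _ _
  · intro b u hu
    rw [Mon_cons]
    exact Set.mul_mem_mul ⟨b, b.2, rfl⟩ hu

theorem UB_cons [DecidableEq ι] {T : Finset (ι × ℕ)} {t : ι × ℕ} (ht : t ∉ T)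
    {R : Multiset ι} {d1 d2 : ℕ} (h1 : UB D.AA (D.KT T) R {t.1} d1)
    (h2 : UB D.AA (D.KT (insert t T)) R 0 d2) :
    UB D.AA (D.KT T) R 0 (d1 + d2) := by
  refine UB_add (D.range_xp t.1) (D.KT_mono (Finset.subset_insert t T)) (D.KT_le_MT ht)
    (D.AA_MT t) D.AA_ne D.AA_0 ?_ (D.kernel t) h1 h2
  rw [KT_insert]
  exact jn_hfr _ _

theorem chain [DecidableEq ι] {T T' : Finset (ι × ℕ)} (h : T ⊆ T') {t : ι × ℕ} (ht : t ∉ T')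
    (hT : T'.card < n) :
    FChain (D.KT T) (D.KT T') (D.KT (insert t T)) (D.KT (insert t T')) := by
  rw [KT_insert, KT_insert]
  exact jn_FChain (D.KT_mono h) (D.zt_AI hT ht)

theorem chain_union [DecidableEq ι] {T T' : Finset (ι × ℕ)} (h : T ⊆ T') (Q : Finset (ι × ℕ))
    (hQ : Disjoint Q T') (hT : (Q ∪ T').card ≤ n) :
    FChain (D.KT T) (D.KT T') (D.KT (Q ∪ T)) (D.KT (Q ∪ T')) := by
  induction Q using Finset.induction_on with
  | empty => simp only [Finset.empty_union]; exact FChain.refl _ _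
  | insert t Q htQ ih =>
    have h1 : t ∉ Q ∪ T' := by
      rw [Finset.mem_union]
      rintro (h | h)
      · exact htQ h
      · exact Finset.disjoint_left.1 hQ (Finset.mem_insert_self _ _) h
    rw [Finset.insert_union, Finset.card_insert_of_notMem h1] at hT
    rw [Finset.insert_union, Finset.insert_union]
    refine (ih (hQ.mono_left (Finset.subset_insert _ _)) (by omega)).trans ?_
    exact D.chain (Finset.union_subset_union_right h) h1 (by omega)

theorem main_ineq [DecidableEq ι] {T T' : Finset (ι × ℕ)} (h : T ⊆ T') (Q : Finset (ι × ℕ))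
    (hQ : Disjoint Q T') (hT : (Q ∪ T').card ≤ n) (R R' : Multiset ι) :
    D.dim T R * D.dim (Q ∪ T') R' ≤ D.dim (Q ∪ T) R * D.dim T' (R + R') := by
  rw [dim, dim, dim, dim, Mon_add]
  exact (D.chain_union h Q hQ hT).ineq (D.Mon_fin _) (D.Mon_fin _)

/-- the sumset -/
def PP (R : Multiset ι) : Set (Fin n → ℕ) := (R.map fun i => (D.S i : Set (Fin n → ℕ))).sum

theorem Mon_eq (R : Multiset ι) : Mon D.AA R = D.xp '' D.PP R := by
  induction R using Multiset.induction_on with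
  | empty =>
    rw [Mon_zero, PP, Multiset.map_zero, Multiset.sum_zero, ← Set.singleton_zero,
      Set.image_singleton, xp_zero]
    rfl
  | cons i R ih =>
    rw [Mon_cons, ih]
    unfold PP
    rw [Multiset.map_cons, Multiset.sum_cons]
    ext y
    simp only [Set.mem_mul, Set.mem_image, Set.mem_add, AA]
    constructor
    · rintro ⟨_, ⟨a, ha, rfl⟩, _, ⟨b, hb, rfl⟩, rfl⟩
      exact ⟨a + b, ⟨a, ha, b, hb, rfl⟩, D.xp_add _ _⟩
    · rintro ⟨_, ⟨a, ha, b, hb, rfl⟩, rfl⟩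
      exact ⟨_, ⟨a, ha, rfl⟩, _, ⟨b, hb, rfl⟩, (D.xp_add _ _).symm⟩

theorem PP_fin (R : Multiset ι) : (D.PP R).Finite := by
  induction R using Multiset.induction_on with
  | empty => simp [PP]
  | cons i R ih =>
    rw [PP, Multiset.map_cons, Multiset.sum_cons]
    exact (D.S i).finite_toSet.add ih

theorem KT_empty_le : D.KT ∅ ≤ jn ℚ (D.v '' ∅) := by
  apply jn_mono
  intro y hy
  rw [Finset.mem_coe, mem_gens] at hy
  simp at hy

theorem xp_li : LinearIndependent (D.KT ∅) D.xp := by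
  have h1 : AlgebraicIndependent (jn ℚ (D.v '' ∅)) (fun j : Fin n => D.v (Sum.inl j)) :=
    jn_AI_comp D.hv (f := Sum.inl) Sum.inl_injective (by simp)
  have e : D.KT ∅ = jn ℚ (D.v '' ∅) := by
    refine le_antisymm D.KT_empty_le (jn_mono (by simp))
  rw [e]
  have h2 := ((MvPolynomial.basisMonomials (Fin n) (jn ℚ (D.v '' ∅))).linearIndependent.map'
    (MvPolynomial.aeval (fun j : Fin n => D.v (Sum.inl j))).toLinearMap
    (LinearMap.ker_eq_bot.2 h1))
  have h3 := h2.comp (Finsupp.equivFunOnFinite.symm : (Fin n → ℕ) ≃ (Fin n →₀ ℕ))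
    (Equiv.injective _)
  have h4 : D.xp = ((MvPolynomial.aeval (R := jn ℚ (D.v '' ∅))
      (fun j : Fin n => D.v (Sum.inl j))).toLinearMap ∘
      (MvPolynomial.basisMonomials (Fin n) (jn ℚ (D.v '' ∅)))) ∘
      (Finsupp.equivFunOnFinite.symm : (Fin n → ℕ) ≃ (Fin n →₀ ℕ)) := by
    ext b
    simp [xp, MvPolynomial.aeval_monomial, Finsupp.prod_fintype]
  rw [h4]
  exact h3

theorem dim_empty (R : Multiset ι) : D.dim ∅ R = (D.PP R).ncard := by
  classical
  obtain ⟨s, hs⟩ := (D.PP_fin R).exists_finset_coe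
  have hinj : Function.Injective D.xp := D.xp_li.injective
  rw [dim, Mon_eq, ← hs, Set.ncard_coe_finset, rk]
  have h1 : LinearIndependent (D.KT ∅) (fun v : (s.image D.xp : Finset L) => (v : L)) := by
    have := (D.xp_li.comp (Subtype.val : s → _) Subtype.val_injective).linearIndepOn_id
    have e : Set.range (D.xp ∘ (Subtype.val : s → _)) = ((s.image D.xp : Finset L) : Set L) := by
      rw [Set.range_comp, Finset.coe_image, Subtype.range_coe_subtype]; rfl
    rw [e] at this
    exact this
  have h2 := finrank_span_finset_eq_card h1
  rw [Finset.card_image_of_injective _ hinj, Finset.coe_image] at h2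
  exact h2

end Setup

theorem exists_setup (n : ℕ) (ι : Type) (S : ι → Finset (Fin n → ℕ)) (b0 : ι → Fin n → ℕ)
    (hb0 : ∀ i, b0 i ∈ S i) (hb1 : ∀ i j, b0 i + Pi.single j 1 ∈ S i) :
    ∃ (L : Type) (_ : Field L) (_ : Algebra ℚ L) (D : Setup n ι L), D.S = S := by
  let R := MvPolynomial (Fin n ⊕ ((ι × ℕ) × (Fin n → ℕ))) ℚ
  have hv := (MvPolynomial.algebraicIndependent_X (Fin n ⊕ ((ι × ℕ) × (Fin n → ℕ))) ℚ).map'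
    (f := IsScalarTower.toAlgHom ℚ R (FractionRing R)) (IsFractionRing.injective R (FractionRing R))
  exact ⟨FractionRing R, inferInstance, _, ⟨_, hv, S, b0, hb0, hb1⟩, rfl⟩

end ConvexPaper

namespace ConvexPaper

theorem li_mul {L : Type*} [Field L] [DecidableEq L] {K : Subfield L} {a : L} (ha : a ≠ 0)
    {b : Finset L} (h : LinearIndependent K (fun v : b => (v : L))) :
    LinearIndependent K (fun v : (b.image fun x => a * x) => (v : L)) ∧
      (b.image fun x => a * x).card = b.card := by
  have hinj : Function.Injective (fun x : L => a * x) := mul_right_injective₀ ha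
  have hc := Finset.card_image_of_injective b hinj
  refine ⟨?_, hc⟩
  have h1 : rk K ((b.image fun x => a * x : Finset L) : Set L) = b.card := by
    rw [Finset.coe_image, rk_mul_left a ha]
    exact finrank_span_finset_eq_card h
  rw [linearIndependent_iff_card_eq_finrank_span, Fintype.card_coe, hc, ← h1]
  unfold rk Set.finrank
  have : Set.range (fun v : (b.image fun x => a * x) => (v : L)) =
      ((b.image fun x => a * x : Finset L) : Set L) := by ext; simp
  rw [this]

namespace Setup
variable {n : ℕ} {ι : Type} [DecidableEq ι] {L : Type} [Field L] [Algebra ℚ L] (D : Setup n ι L)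

set_option linter.unusedSectionVars false
theorem enum_cons (i : ι) (μ : Multiset ι) :
    (i ::ₘ μ).toEnumFinset = insert (i, μ.count i) μ.toEnumFinset := by
  ext ⟨a, k⟩
  simp only [Multiset.mem_toEnumFinset, Finset.mem_insert, Prod.mk.injEq, Multiset.count_cons]
  split_ifs with h
  · subst h; simp only [true_and]; omega
  · simp [h]

theorem enum_notMem (i : ι) (μ : Multiset ι) : (i, μ.count i) ∉ μ.toEnumFinset := by simp

noncomputable def d (μ R : Multiset ι) : ℕ := D.dim μ.toEnumFinset R

def ub (μ R : Multiset ι) (e : ℕ) : Prop := UB D.AA (D.KT μ.toEnumFinset) R 0 e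

theorem d_cons {μ : Multiset ι} (hμ : μ.card < n) (i : ι) (R : Multiset ι) :
    D.d μ R + D.d (i ::ₘ μ) (i ::ₘ R) ≤ D.d μ (i ::ₘ R) := by
  rw [d, d, d, enum_cons]
  exact D.dim_add_le (by rwa [Multiset.card_toEnumFinset]) (enum_notMem i μ) R

theorem ub_cons {μ R : Multiset ι} {i : ι} {a b : ℕ} (h1 : D.ub μ R a)
    (h2 : D.ub (i ::ₘ μ) (i ::ₘ R) b) : D.ub μ (i ::ₘ R) (a + b) := by
  rw [ub, enum_cons] at h2
  refine D.UB_cons (enum_notMem i μ) ?_ h2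
  intro B hB hli
  exact h1 B (fun x hx => (hB x hx).shift) hli

theorem ub_zero {μ : Multiset ι} (hμ : μ.card < n) {i : ι} {b : ℕ}
    (h2 : D.ub (i ::ₘ μ) 0 b) : D.ub μ 0 b := by
  rw [ub, enum_cons] at h2
  have h1 : UB D.AA (D.KT μ.toEnumFinset) 0 {i} 0 := by
    intro B hB hli
    rw [Nat.le_zero, Finset.card_eq_zero, Finset.eq_empty_iff_forall_notMem]
    intro x hx
    have := D.col_zero (by rwa [Multiset.card_toEnumFinset]) (hB x hx)
    exact hli.ne_zero (⟨x, hx⟩ : B) this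
  have := D.UB_cons (enum_notMem i μ) h1 h2
  rwa [zero_add] at this

theorem d_le_ub {μ R : Multiset ι} {e : ℕ} (h : D.ub μ R e) : D.d μ R ≤ e := by
  obtain ⟨b, hb, hc, hli, -⟩ := exists_basis_subset (D.KT μ.toEnumFinset) _ (D.Mon_fin R)
  rw [d, dim, ← hc]
  exact h b (fun x hx => Col.of_mem (hb hx)) hli

theorem d_mono (μ P R : Multiset ι) : D.d μ R ≤ D.d μ (P + R) := by
  obtain ⟨a, ha⟩ := Mon_nonempty D.AA_ne P
  rw [d, d, dim, dim, ← rk_mul_left a (Mon_nonzero D.AA_0 P a ha)]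
  refine rk_mono (D.Mon_fin _) ?_
  rintro _ ⟨x, hx, rfl⟩
  rw [Mon_add]
  exact Set.mul_mem_mul ha hx

theorem ub_anti {μ P R : Multiset ι} {e : ℕ} (h : D.ub μ (P + R) e) : D.ub μ R e := by
  classical
  obtain ⟨a, ha⟩ := Mon_nonempty D.AA_ne P
  intro b hb hli
  obtain ⟨h1, h2⟩ := li_mul (Mon_nonzero D.AA_0 P a ha) hli
  rw [← h2]
  refine h _ (fun x hx => ?_) h1
  obtain ⟨y, hy, rfl⟩ := Finset.mem_image.1 hx
  exact (hb y hy).mul ha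

theorem d_anti_ub {μ R : Multiset ι} {e : ℕ} (h : ∀ P, D.d μ P ≤ e) : D.ub μ R e := by
  classical
  intro b hb hli
  obtain ⟨c, hc⟩ := Col.common b hb
  obtain ⟨a, ha⟩ := Mon_nonempty D.AA_ne (0 + c)
  obtain ⟨h1, h2⟩ := li_mul (Mon_nonzero D.AA_0 _ a ha) hli
  rw [← h2]
  refine (card_le_rk (D.Mon_fin (R + c)) ?_ h1).trans (h _)
  intro x hx
  obtain ⟨y, hy, rfl⟩ := Finset.mem_image.1 (Finset.mem_coe.1 hx)
  change a * y ∈ _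
  rw [mul_comm]
  exact hc y hy a ha

theorem d_nsmul {μ : Multiset ι} (hμ : μ.card < n) (i : ι) (R : Multiset ι) (q : ℕ) :
    q * D.d (i ::ₘ μ) R ≤ D.d μ (q • {i} + R) := by
  induction q with
  | zero => simp
  | succ q ih =>
    have h1 := D.d_cons hμ i (q • {i} + R)
    have h2 := D.d_mono (i ::ₘ μ) ((q + 1) • {i}) R
    have e : i ::ₘ (q • {i} + R) = (q + 1) • {i} + R := by
      rw [succ_nsmul', add_assoc, Multiset.singleton_add]
    rw [e] at h1
    linarith

theorem d_pow (q : ℕ) (μ : Multiset ι) : ∀ (R : Multiset ι), μ.card ≤ n →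
    q ^ μ.card * D.d μ R ≤ D.d 0 (q • μ + R) := by
  induction μ using Multiset.induction_on with
  | empty => intro R _; simp
  | cons i μ ih =>
    intro R h
    rw [Multiset.card_cons] at h ⊢
    have h1 := D.d_nsmul (μ := μ) (by omega) i R q
    have h2 := ih (q • {i} + R) (by omega)
    have e : q • (i ::ₘ μ) + R = q • μ + (q • {i} + R) := by
      rw [← Multiset.singleton_add, nsmul_add]; abel
    rw [e, pow_succ, mul_assoc]
    exact (Nat.mul_le_mul_left _ h1).trans h2

theorem d_zero (R : Multiset ι) : D.d 0 R = (D.PP R).ncard := by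
  rw [d, ← dim_empty]; rfl

theorem PP_bound {c : ℕ} (hc : ∀ i, ∀ b ∈ D.S i, ∀ j, b j ≤ c) (R : Multiset ι) :
    ∀ b ∈ D.PP R, ∀ j, b j ≤ c * R.card := by
  induction R using Multiset.induction_on with
  | empty => intro b hb j; simp [PP] at hb; simp [hb]
  | cons i R ih =>
    unfold PP at *
    rw [Multiset.map_cons, Multiset.sum_cons]
    rintro _ ⟨a, ha, b, hb, rfl⟩ j
    have h1 := hc i a ha j
    have h2 := ih b hb j
    simp only [Multiset.card_cons, Pi.add_apply]
    linarith

theorem PP_card {c : ℕ} (hc : ∀ i, ∀ b ∈ D.S i, ∀ j, b j ≤ c) (R : Multiset ι) :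
    (D.PP R).ncard ≤ (c * R.card + 1) ^ n := by
  have : D.PP R ⊆ (Fintype.piFinset fun _ : Fin n => Finset.range (c * R.card + 1) : Finset _) := by
    intro b hb
    rw [Finset.mem_coe, Fintype.mem_piFinset]
    intro j
    rw [Finset.mem_range]
    have := D.PP_bound hc R b hb j
    omega
  refine (Set.ncard_le_ncard this (Finset.finite_toSet _)).trans ?_
  rw [Set.ncard_coe_finset, Fintype.card_piFinset]
  simp

theorem exists_c [Finite ι] : ∃ c : ℕ, ∀ i, ∀ b ∈ D.S i, ∀ j, b j ≤ c := by
  cases nonempty_fintype ι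
  refine ⟨Finset.univ.sup fun i => (D.S i).sup fun b => Finset.univ.sup b, fun i b hb j => ?_⟩
  refine le_trans ?_ (Finset.le_sup (f := fun i => (D.S i).sup fun b => Finset.univ.sup b)
    (Finset.mem_univ i))
  refine le_trans ?_ (Finset.le_sup (f := fun b : Fin n → ℕ => Finset.univ.sup b) hb)
  exact Finset.le_sup (Finset.mem_univ j)

theorem d_bdd [Finite ι] {μ : Multiset ι} (hμ : μ.card = n) : ∃ C, ∀ R, D.d μ R ≤ C := by
  obtain ⟨c, hc⟩ := D.exists_c
  refine ⟨(c * (n + 1) + 1) ^ n, fun R => ?_⟩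
  have h1 := D.d_pow (R.card + 1) μ R hμ.le
  have h2 := D.PP_card hc ((R.card + 1) • μ + R)
  rw [← d_zero] at h2
  have h3 := h1.trans h2
  rw [hμ, Multiset.card_add, Multiset.card_nsmul, hμ] at h3
  have h4 : c * ((R.card + 1) * n + R.card) + 1 ≤ (R.card + 1) * (c * (n + 1) + 1) := by nlinarith
  have h5 := h3.trans (Nat.pow_le_pow_left h4 n)
  rw [mul_pow] at h5
  exact Nat.le_of_mul_le_mul_left h5 (by positivity)

/-- the mixed degree -/
noncomputable def N (μ : Multiset ι) : ℕ := sSup (Set.range (D.d μ))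

theorem d_le_N [Finite ι] {μ : Multiset ι} (hμ : μ.card = n) (R : Multiset ι) :
    D.d μ R ≤ D.N μ := by
  obtain ⟨C, hC⟩ := D.d_bdd hμ
  exact le_csSup ⟨C, by rintro _ ⟨R, rfl⟩; exact hC R⟩ ⟨R, rfl⟩

theorem exists_d_eq_N [Finite ι] {μ : Multiset ι} (hμ : μ.card = n) :
    ∃ R, D.d μ R = D.N μ := by
  obtain ⟨C, hC⟩ := D.d_bdd hμ
  exact Nat.sSup_mem (Set.range_nonempty _) ⟨C, by rintro _ ⟨R, rfl⟩; exact hC R⟩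

theorem ub_N [Finite ι] {μ : Multiset ι} (hμ : μ.card = n) (R : Multiset ι) :
    D.ub μ R (D.N μ) := D.d_anti_ub (D.d_le_N hμ)

theorem PP_add (R Q : Multiset ι) : D.PP (R + Q) = D.PP R + D.PP Q := by simp [PP]

theorem PP_single (i : ι) : D.PP {i} = D.S i := by simp [PP]

theorem PP_b0 (i : ι) (J : ℕ) : ∀ b : Fin n → ℕ, ∑ j, b j ≤ J →
    J • D.b0 i + b ∈ D.PP (J • {i}) := by
  induction J with
  | zero =>
    intro b hb
    have : b = 0 := by
      ext j
      simpa using (Finset.single_le_sum (f := b) (fun _ _ => Nat.zero_le _)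
        (Finset.mem_univ j)).trans hb
    simp [PP, this]
  | succ J ih =>
    intro b hb
    rw [succ_nsmul _ J, PP_add, PP_single]
    by_cases h0 : b = 0
    · refine ⟨J • D.b0 i, ?_, D.b0 i, D.hb0 i, ?_⟩
      · simpa using ih 0 (by simp)
      · rw [h0, add_zero, succ_nsmul]
    · obtain ⟨j, hj⟩ := Function.ne_iff.1 h0
      have hj : b j ≠ 0 := hj
      have e : b = (b - Pi.single j 1) + Pi.single j 1 := by
        ext k
        by_cases hk : k = j
        · subst hk; simp; omega
        · simp [hk]
      refine ⟨J • D.b0 i + (b - Pi.single j 1), ih _ ?_, D.b0 i + Pi.single j 1, D.hb1 i j, ?_⟩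
      · have : ∑ k, b k = ∑ k, (b - Pi.single j 1 : Fin n → ℕ) k + 1 := by
          conv_lhs => rw [e]
          simp [Finset.sum_add_distrib, -Pi.sub_apply]
        omega
      · change J • D.b0 i + (b - Pi.single j 1) + (D.b0 i + Pi.single j 1) = _
        conv_rhs => rw [e]
        rw [succ_nsmul, add_add_add_comm]

theorem d_single_ge [Finite ι] {μ : Multiset ι} (hμ : μ.card = n) (i : ι) :
    ∃ J : ℕ, ∀ j : ℕ, J ≤ j → D.d μ (j • {i}) = D.N μ := by
  obtain ⟨R, hR⟩ := D.exists_d_eq_N hμ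
  obtain ⟨c, hc⟩ := D.exists_c
  refine ⟨n * (c * R.card), fun j hj => le_antisymm (D.d_le_N hμ _) ?_⟩
  rw [← hR, d, d, dim, dim, ← rk_mul_left (D.xp (j • D.b0 i)) (D.xp_ne _)]
  refine rk_mono (D.Mon_fin _) ?_
  rw [Mon_eq, Mon_eq]
  rintro _ ⟨_, ⟨b, hb, rfl⟩, rfl⟩
  refine ⟨j • D.b0 i + b, D.PP_b0 i j b ?_, D.xp_add _ _⟩
  refine le_trans ?_ hj
  refine (Finset.sum_le_card_nsmul _ _ _ fun k _ => D.PP_bound hc R b hb k).trans ?_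
  simp

theorem d_ge [Finite ι] {μ l : Multiset ι} (hμ : μ.card = n) (hl : l ≠ 0) :
    ∃ J : ℕ, ∀ j : ℕ, J ≤ j → D.d μ (j • l) = D.N μ := by
  obtain ⟨i, hi⟩ := Multiset.exists_mem_of_ne_zero hl
  obtain ⟨l', rfl⟩ := Multiset.exists_cons_of_mem hi
  obtain ⟨J, hJ⟩ := D.d_single_ge hμ i
  refine ⟨J, fun j hj => le_antisymm (D.d_le_N hμ _) ?_⟩
  rw [← hJ j hj, ← Multiset.singleton_add, nsmul_add, add_comm]
  exact D.d_mono _ _ _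

end Setup
end ConvexPaper

namespace ConvexPaper
open Filter Topology

theorem pow_diff_le (r : ℕ) (k : ℕ) :
    ((r : ℝ) + 1) * (k : ℝ) ^ r ≤ ((k : ℝ) + 1) ^ (r + 1) - (k : ℝ) ^ (r + 1) ∧
    ((k : ℝ) + 1) ^ (r + 1) - (k : ℝ) ^ (r + 1) ≤ ((r : ℝ) + 1) * ((k : ℝ) + 1) ^ r := by
  induction r with
  | zero => simp
  | succ r ih =>
    obtain ⟨h1, h2⟩ := ih
    have hk : (0 : ℝ) ≤ k := by positivity
    have h3 : (k : ℝ) ^ (r + 1) ≤ ((k : ℝ) + 1) ^ (r + 1) := by gcongr; linarith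
    push_cast
    constructor
    · have := mul_le_mul_of_nonneg_left h1 hk
      rw [pow_succ ((k : ℝ) + 1) (r + 1)]
      rw [pow_succ (k : ℝ) (r + 1)]
      have e : (k : ℝ) ^ (r + 1) = k * k ^ r := by ring
      nlinarith
    · have := mul_le_mul_of_nonneg_right h2 (by linarith : (0 : ℝ) ≤ k + 1)
      have e : ((k : ℝ) + 1) ^ (r + 1) = (k + 1) * (k + 1) ^ r := by ring
      have e2 : ((k : ℝ) + 1) ^ (r + 1 + 1) = (k + 1) * (k + 1) ^ (r + 1) := by ring
      have e3 : (k : ℝ) ^ (r + 1 + 1) = k * k ^ (r + 1) := by ring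
      nlinarith

theorem sum_pow_lim (r : ℕ) :
    Tendsto (fun j : ℕ => (∑ k ∈ Finset.range j, (k : ℝ) ^ r) / (j : ℝ) ^ (r + 1)) atTop
      (𝓝 (1 / ((r : ℝ) + 1))) := by
  have hr : (0 : ℝ) < r + 1 := by positivity
  have tel : ∀ j : ℕ, ∑ k ∈ Finset.range j, (((k : ℝ) + 1) ^ (r + 1) - (k : ℝ) ^ (r + 1)) =
      (j : ℝ) ^ (r + 1) := by
    intro j
    have := Finset.sum_range_sub (fun k : ℕ => (k : ℝ) ^ (r + 1)) j
    simpa using this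
  have up : ∀ j : ℕ, (r + 1) * ∑ k ∈ Finset.range j, (k : ℝ) ^ r ≤ (j : ℝ) ^ (r + 1) := by
    intro j
    rw [← tel, Finset.mul_sum]
    exact Finset.sum_le_sum fun k _ => (pow_diff_le r k).1
  have lo : ∀ j : ℕ, (j : ℝ) ^ (r + 1) ≤
      (r + 1) * (∑ k ∈ Finset.range j, (k : ℝ) ^ r + (j : ℝ) ^ r) := by
    intro j
    rw [← Finset.sum_range_succ, Finset.sum_range_succ', ← tel]
    have : (0 : ℝ) ≤ ((0 : ℕ) : ℝ) ^ r := by positivity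
    have h : ∑ k ∈ Finset.range j, (((k : ℝ) + 1) ^ (r + 1) - (k : ℝ) ^ (r + 1)) ≤
      (r + 1) * ∑ k ∈ Finset.range j, ((k + 1 : ℕ) : ℝ) ^ r := by
      rw [Finset.mul_sum]
      refine Finset.sum_le_sum fun k _ => ?_
      push_cast
      exact (pow_diff_le r k).2
    nlinarith
  have hinv : Tendsto (fun j : ℕ => 1 / ((r : ℝ) + 1) - (j : ℝ)⁻¹) atTop
      (𝓝 (1 / ((r : ℝ) + 1))) := by
    have := (tendsto_const_nhds (x := 1 / ((r : ℝ) + 1))).sub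
      (tendsto_inv_atTop_nhds_zero_nat (𝕜 := ℝ))
    simpa using this
  refine tendsto_of_tendsto_of_tendsto_of_le_of_le' hinv tendsto_const_nhds ?_ ?_
  · filter_upwards [eventually_gt_atTop 0] with j hj
    have hj' : (0 : ℝ) < j := by exact_mod_cast hj
    have := lo j
    rw [le_div_iff₀ (by positivity)]
    have e : (1 / ((r : ℝ) + 1) - (j : ℝ)⁻¹) * (j : ℝ) ^ (r + 1) =
      1 / ((r : ℝ) + 1) * (j : ℝ) ^ (r + 1) - (j : ℝ) ^ r := by field_simp; ring
    rw [e, sub_le_iff_le_add, one_div_mul_eq_div, div_le_iff₀ hr]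
    linarith
  · filter_upwards [eventually_gt_atTop 0] with j hj
    have hj' : (0 : ℝ) < j := by exact_mod_cast hj
    rw [div_le_div_iff₀ (by positivity) hr]
    linarith [up j]

theorem stolz (r : ℕ) (w : ℕ → ℝ) (c : ℝ)
    (hw : Tendsto (fun k : ℕ => w k / (k : ℝ) ^ r) atTop (𝓝 c)) :
    Tendsto (fun j : ℕ => (∑ k ∈ Finset.range j, w k) / (j : ℝ) ^ (r + 1)) atTop
      (𝓝 (c / ((r : ℝ) + 1))) := by
  have hs := sum_pow_lim r
  have h1 : (fun k : ℕ => w k - c * (k : ℝ) ^ r) =o[atTop] fun k : ℕ => (k : ℝ) ^ r := by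
    rw [Asymptotics.isLittleO_iff_tendsto']
    · have : Tendsto (fun k : ℕ => w k / (k : ℝ) ^ r - c) atTop (𝓝 (c - c)) :=
        hw.sub tendsto_const_nhds
      rw [sub_self] at this
      refine this.congr' ?_
      filter_upwards [eventually_gt_atTop 0] with j hj
      have hj' : (0 : ℝ) < j := by exact_mod_cast hj
      field_simp
    · filter_upwards [eventually_gt_atTop 0] with j hj h
      have hj' : (0 : ℝ) < j := by exact_mod_cast hj
      exact absurd h (by positivity)
  have h2 : Tendsto (fun j : ℕ => ∑ k ∈ Finset.range j, (k : ℝ) ^ r) atTop atTop := by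
    have h3 : Tendsto (fun j : ℕ => (j : ℝ) ^ (r + 1)) atTop atTop :=
      (tendsto_pow_atTop (Nat.succ_ne_zero r)).comp tendsto_natCast_atTop_atTop
    have := h3.atTop_mul_pos (by positivity) hs
    refine this.congr' ?_
    filter_upwards [eventually_gt_atTop 0] with j hj
    have hj' : (0 : ℝ) < j := by exact_mod_cast hj
    field_simp
  have h3 := h1.sum_range (fun k => by positivity) h2
  have h4 := h3.tendsto_div_nhds_zero
  have h5 := (h4.mul hs).add (hs.const_mul c)
  rw [zero_mul, zero_add, mul_one_div] at h5
  refine h5.congr' ?_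
  filter_upwards [eventually_gt_atTop 0, h2.eventually_gt_atTop 0] with j hj hp
  have hj' : (0 : ℝ) < j := by exact_mod_cast hj
  rw [Finset.sum_sub_distrib, ← Finset.mul_sum]
  field_simp
  ring

theorem shift_lim (r : ℕ) (w : ℕ → ℝ) (c : ℝ)
    (hw : Tendsto (fun k : ℕ => w k / (k : ℝ) ^ r) atTop (𝓝 c)) :
    Tendsto (fun k : ℕ => w (k + 1) / (k : ℝ) ^ r) atTop (𝓝 c) := by
  have h1 := hw.comp (tendsto_add_atTop_nat 1)
  have h2 : Tendsto (fun k : ℕ => (1 + (k : ℝ)⁻¹) ^ r) atTop (𝓝 1) := by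
    have := ((tendsto_const_nhds (x := (1 : ℝ))).add
      (tendsto_inv_atTop_nhds_zero_nat (𝕜 := ℝ))).pow r
    simpa using this
  have h3 := h1.mul h2
  rw [mul_one] at h3
  refine h3.congr' ?_
  filter_upwards [eventually_gt_atTop 0] with j hj
  have hj' : (0 : ℝ) < j := by exact_mod_cast hj
  have e : (1 + (j : ℝ)⁻¹) = ((j : ℝ) + 1) / j := by field_simp
  simp only [Function.comp]
  rw [e, div_pow]
  push_cast
  field_simp

theorem ms_lim {ι : Type*} (l : Multiset ι) (f : ι → ℕ → ℝ) (c : ι → ℝ)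
    (h : ∀ i, Tendsto (f i) atTop (𝓝 (c i))) :
    Tendsto (fun k => (l.map fun i => f i k).sum) atTop (𝓝 (l.map c).sum) := by
  induction l using Multiset.induction_on with
  | empty => simp
  | cons i l ih => simpa using (h i).add ih

namespace Setup
variable {n : ℕ} {ι : Type} [DecidableEq ι] {L : Type} [Field L] [Algebra ℚ L] (D : Setup n ι L)

theorem d_lower {μ : Multiset ι} (hμ : μ.card < n) (l R : Multiset ι) :
    D.d μ R + (l.map fun i => D.d (i ::ₘ μ) R).sum ≤ D.d μ (l + R) := by
  induction l using Multiset.induction_on with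
  | empty => simp
  | cons i l ih =>
    rw [Multiset.map_cons, Multiset.sum_cons, Multiset.cons_add]
    have h1 := D.d_cons hμ i (l + R)
    have h2 := D.d_mono (i ::ₘ μ) (i ::ₘ l) R
    rw [Multiset.cons_add] at h2
    linarith

theorem ub_upper {μ : Multiset ι} (l R : Multiset ι) (a : ℕ) (b : ι → ℕ) (h1 : D.ub μ R a)
    (h2 : ∀ i ∈ l, D.ub (i ::ₘ μ) (l + R) (b i)) : D.ub μ (l + R) (a + (l.map b).sum) := by
  induction l using Multiset.induction_on with
  | empty => simpa using h1
  | cons i l ih =>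
    rw [Multiset.map_cons, Multiset.sum_cons, Multiset.cons_add]
    have h3 := ih fun i' hi' => by
      have := h2 i' (Multiset.mem_cons_of_mem hi')
      rw [← Multiset.singleton_add i l, add_assoc] at this
      exact D.ub_anti this
    have h4 := h2 i (Multiset.mem_cons_self _ _)
    rw [Multiset.cons_add] at h4
    have := D.ub_cons h3 h4
    rwa [add_assoc, add_comm _ (b i)] at this

/-- leading coefficient -/
noncomputable def p : ℕ → Multiset ι → Multiset ι → ℝ
  | 0, μ, _ => D.N μ
  | r + 1, μ, l => (l.map fun i => p r (i ::ₘ μ) l).sum / ((r : ℝ) + 1)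

theorem lim_aux [Finite ι] (l : Multiset ι) (hl : l ≠ 0) (r : ℕ) : ∀ μ : Multiset ι,
    μ.card + r = n →
    (∃ u : ℕ → ℕ, (∀ j, D.ub μ (j • l) (u j)) ∧
      Tendsto (fun j : ℕ => (u j : ℝ) / (j : ℝ) ^ r) atTop (𝓝 (D.p r μ l))) ∧
    Tendsto (fun j : ℕ => (D.d μ (j • l) : ℝ) / (j : ℝ) ^ r) atTop (𝓝 (D.p r μ l)) := by
  induction r with
  | zero =>
    intro μ hμ
    refine ⟨⟨fun _ => D.N μ, fun j => D.ub_N hμ _, by simp [p]⟩, ?_⟩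
    obtain ⟨J, hJ⟩ := D.d_ge hμ hl
    refine tendsto_const_nhds.congr' ?_
    filter_upwards [eventually_ge_atTop J] with j hj
    simp [hJ j hj, p]
  | succ r ih =>
    intro μ hμ
    have hc : ∀ i, (i ::ₘ μ).card + r = n := fun i => by rw [Multiset.card_cons]; omega
    choose u hu1 hu2 using fun i => (ih (i ::ₘ μ) (hc i)).1
    have hd := fun i => (ih (i ::ₘ μ) (hc i)).2
    obtain ⟨i0, hi0⟩ := Multiset.exists_mem_of_ne_zero hl
    have hub : ∀ j, D.ub μ (j • l)
        (u i0 0 + ∑ k ∈ Finset.range j, (l.map fun i => u i (k + 1)).sum) := by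
      intro j
      induction j with
      | zero =>
        have := hu1 i0 0
        rw [zero_nsmul] at this ⊢
        simpa using D.ub_zero (by omega) this
      | succ j ihj =>
        rw [Finset.sum_range_succ, ← add_assoc, succ_nsmul']
        refine D.ub_upper l _ _ _ ihj fun i _ => ?_
        have := hu1 i (j + 1)
        rwa [succ_nsmul'] at this
    have hlo : ∀ j, ∑ k ∈ Finset.range j, (l.map fun i => D.d (i ::ₘ μ) (k • l)).sum ≤
        D.d μ (j • l) := by
      intro j
      induction j with
      | zero => simp
      | succ j ihj =>
        rw [Finset.sum_range_succ, succ_nsmul']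
        have := D.d_lower (μ := μ) (by omega) l (j • l)
        linarith
    have hT1 : Tendsto (fun j : ℕ => ((u i0 0 + ∑ k ∈ Finset.range j,
        (l.map fun i => u i (k + 1)).sum : ℕ) : ℝ) / (j : ℝ) ^ (r + 1)) atTop
        (𝓝 (D.p (r + 1) μ l)) := by
      have a1 := ms_lim l (fun i k => (u i (k + 1) : ℝ) / (k : ℝ) ^ r) (fun i => D.p r (i ::ₘ μ) l)
        fun i => shift_lim r (fun k => (u i k : ℝ)) _ (hu2 i)
      have a2 := stolz r (fun k => (l.map fun i => (u i (k + 1) : ℝ)).sum) _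
        (a1.congr fun k => by rw [Multiset.sum_map_div])
      have a3 : Tendsto (fun j : ℕ => (u i0 0 : ℝ) / (j : ℝ) ^ (r + 1)) atTop (𝓝 0) :=
        Tendsto.div_atTop tendsto_const_nhds
          ((tendsto_pow_atTop (Nat.succ_ne_zero r)).comp tendsto_natCast_atTop_atTop)
      have a4 := a3.add a2
      rw [zero_add] at a4
      refine a4.congr fun j => ?_
      push_cast
      rw [add_div]
      simp [Multiset.map_map, Function.comp_def]
    have hT2 : Tendsto (fun j : ℕ => ((∑ k ∈ Finset.range j,
        (l.map fun i => D.d (i ::ₘ μ) (k • l)).sum : ℕ) : ℝ) / (j : ℝ) ^ (r + 1)) atTop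
        (𝓝 (D.p (r + 1) μ l)) := by
      have a1 := ms_lim l (fun i k => (D.d (i ::ₘ μ) (k • l) : ℝ) / (k : ℝ) ^ r)
        (fun i => D.p r (i ::ₘ μ) l) hd
      have a2 := stolz r (fun k => (l.map fun i => (D.d (i ::ₘ μ) (k • l) : ℝ)).sum) _
        (a1.congr fun k => by rw [Multiset.sum_map_div])
      refine a2.congr fun j => ?_
      push_cast
      simp [Multiset.map_map, Function.comp_def]
    refine ⟨⟨_, hub, hT1⟩, ?_⟩
    refine tendsto_of_tendsto_of_tendsto_of_le_of_le hT2 hT1 (fun j => ?_) (fun j => ?_)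
    · have := hlo j
      dsimp only
      gcongr
    · have := D.d_le_ub (hub j)
      dsimp only
      gcongr

theorem d_lim [Finite ι] {l : Multiset ι} (hl : l ≠ 0) {r : ℕ} {μ : Multiset ι}
    (h : μ.card + r = n) :
    Tendsto (fun j : ℕ => (D.d μ (j • l) : ℝ) / (j : ℝ) ^ r) atTop (𝓝 (D.p r μ l)) :=
  (D.lim_aux l hl r μ h).2

theorem p_single (i : ι) (r : ℕ) : ∀ μ : Multiset ι,
    D.p r μ {i} = D.N (μ + Multiset.replicate r i) / r.factorial := by
  induction r with
  | zero => intro μ; simp [p]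
  | succ r ih =>
    intro μ
    simp only [p, Multiset.map_singleton, Multiset.sum_singleton, ih]
    rw [Multiset.replicate_succ, Multiset.cons_add, Multiset.add_cons, Nat.factorial_succ]
    push_cast
    field_simp

theorem p_formula {σ : Type} (φ : σ → ι) (s : Finset σ) (r : ℕ) :
    ∀ μ : Multiset ι, (r.factorial : ℝ) * D.p r μ (s.val.map φ) =
      ∑ χ ∈ Fintype.piFinset (fun _ : Fin r => s),
        (D.N (μ + (Finset.univ.val.map fun a => φ (χ a))) : ℝ) := by
  induction r with
  | zero =>
    intro μ
    simp [p]
  | succ r ih =>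
    intro μ
    have h1 : (((r + 1).factorial : ℕ) : ℝ) * D.p (r + 1) μ (s.val.map φ) =
        ∑ i ∈ s, (r.factorial : ℝ) * D.p r (φ i ::ₘ μ) (s.val.map φ) := by
      rw [← Finset.mul_sum]
      simp only [p, Multiset.map_map, Function.comp_def]
      rw [Nat.factorial_succ, Finset.sum]
      push_cast
      field_simp
    rw [h1]
    simp only [ih]
    rw [← Finset.sum_product']
    refine Finset.sum_bij' (fun x _ => (Fin.cons x.1 x.2 : Fin (r + 1) → σ))
      (fun χ _ => (χ 0, Fin.tail χ)) ?_ ?_ ?_ ?_ ?_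
    · rintro ⟨i, χ⟩ h
      simp only [Finset.mem_product, Fintype.mem_piFinset] at h ⊢
      intro a
      refine Fin.cases ?_ (fun a => ?_) a
      · exact h.1
      · exact h.2 a
    · intro χ h
      simp only [Finset.mem_product, Fintype.mem_piFinset] at h ⊢
      exact ⟨h 0, fun a => h _⟩
    · rintro ⟨i, χ⟩ _; simp
    · intro χ _; simp
    · rintro ⟨i, χ⟩ _
      congr 2
      rw [Fin.univ_succ]
      simp [Function.comp_def]
      rw [← Multiset.cons_coe, Multiset.add_cons]

end Setup
end ConvexPaper

namespace ConvexPaper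
open Filter Topology

/-- the inclusion of natural vectors into real vectors -/
def cH (n : ℕ) : (Fin n → ℕ) →+ (Fin n → ℝ) where
  toFun b := fun j => (b j : ℝ)
  map_zero' := by ext; simp
  map_add' a b := by ext; simp

theorem cH_apply {n : ℕ} (b : Fin n → ℕ) (j : Fin n) : cH n b j = (b j : ℝ) := rfl

theorem cH_inj (n : ℕ) : Function.Injective (cH n) := by
  intro a b h
  ext j
  have := congrFun h j
  simpa [cH_apply] using this

theorem shift_lim' (r : ℕ) (w : ℕ → ℝ) (c : ℝ)
    (hw : Tendsto (fun k : ℕ => w k / (k : ℝ) ^ r) atTop (𝓝 c)) (e : ℕ) :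
    Tendsto (fun k : ℕ => w (k + e) / (k : ℝ) ^ r) atTop (𝓝 c) := by
  induction e with
  | zero => simpa using hw
  | succ e ih =>
    have := shift_lim r (fun k => w (k + e)) c ih
    refine this.congr fun k => ?_
    rw [add_assoc, add_comm 1 e]

namespace Setup
variable {n : ℕ} {ι : Type} [DecidableEq ι] {L : Type} [Field L] [Algebra ℚ L] (D : Setup n ι L)
set_option linter.unusedSectionVars false

theorem PP_zero : D.PP 0 = {0} := by unfold PP; simp; rfl

theorem PP_succ (l : Multiset ι) (j : ℕ) : D.PP ((j + 1) • l) = D.PP (j • l) + D.PP l := by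
  rw [succ_nsmul, PP_add]

theorem PP_addn (l : Multiset ι) (j k : ℕ) :
    D.PP ((j + k) • l) = D.PP (j • l) + D.PP (k • l) := by
  rw [add_nsmul, PP_add]

theorem PP_mulmem {l : Multiset ι} {q : Fin n → ℕ} (hq : q ∈ D.PP l) (a : ℕ) :
    (fun k => a * q k) ∈ D.PP (a • l) := by
  induction a with
  | zero =>
    rw [zero_nsmul, PP_zero, Set.mem_singleton_iff]; ext; simp
  | succ a ih =>
    rw [PP_succ]
    refine ⟨_, ih, _, hq, ?_⟩
    ext k; simp; ring

theorem PP_summem {l : Multiset ι} (s : Finset (Fin n → ℕ)) (hs : ∀ q ∈ s, q ∈ D.PP l)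
    (a : (Fin n → ℕ) → ℕ) :
    (fun k => ∑ q ∈ s, a q * q k) ∈ D.PP ((∑ q ∈ s, a q) • l) := by
  induction s using Finset.induction_on with
  | empty => rw [Finset.sum_empty, zero_nsmul, PP_zero, Set.mem_singleton_iff]; ext; simp
  | insert q s hq ih =>
    rw [Finset.sum_insert hq, PP_addn]
    refine ⟨_, D.PP_mulmem (hs q (Finset.mem_insert_self _ _)) (a q), _,
      ih fun q' hq' => hs q' (Finset.mem_insert_of_mem hq'), ?_⟩
    ext k
    simp [Finset.sum_insert hq]

theorem PP_nonempty (l : Multiset ι) : (D.PP l).Nonempty := by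
  induction l using Multiset.induction_on with
  | empty => rw [PP_zero]; exact ⟨0, rfl⟩
  | cons i l ih =>
    rw [← Multiset.singleton_add, PP_add, PP_single]
    exact Set.Nonempty.add ⟨_, D.hb0 i⟩ ih

/-- base point of the sum -/
theorem PP_corner {l : Multiset ι} (hl : l ≠ 0) : ∃ q : Fin n → ℕ, ∀ J : ℕ, ∀ b : Fin n → ℕ,
    ∑ j, b j ≤ J → (fun k => J * q k + b k) ∈ D.PP (J • l) := by
  obtain ⟨i, hi⟩ := Multiset.exists_mem_of_ne_zero hl
  obtain ⟨l', rfl⟩ := Multiset.exists_cons_of_mem hi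
  obtain ⟨q', hq'⟩ := D.PP_nonempty l'
  refine ⟨D.b0 i + q', fun J b hb => ?_⟩
  rw [← Multiset.singleton_add, nsmul_add, PP_add]
  refine ⟨_, D.PP_b0 i J b hb, _, D.PP_mulmem hq' J, ?_⟩
  ext k
  simp only [Pi.add_apply, Pi.smul_apply, smul_eq_mul]
  ring

/-- the polytope of a multiset -/
noncomputable def QQ (l : Multiset ι) : Set (Fin n → ℝ) := convexHull ℝ (cH n '' D.PP l)

theorem PP_sub (l : Multiset ι) (j : ℕ) : cH n '' D.PP (j • l) ⊆ (j : ℝ) • D.QQ l := by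
  have hne : (D.QQ l).Nonempty := ((D.PP_nonempty l).image _).convexHull
  induction j with
  | zero =>
    rw [zero_nsmul, PP_zero, Nat.cast_zero, Set.zero_smul_set hne]
    simp
  | succ j ih =>
    rw [PP_succ, Set.image_add, Nat.cast_succ,
      Convex.add_smul (s := D.QQ l) (convex_convexHull ℝ _) (Nat.cast_nonneg j) zero_le_one, one_smul]
    exact Set.add_subset_add ih (subset_convexHull ℝ _)

theorem QQ_decomp {l : Multiset ι} (hl : l ≠ 0) : ∃ (E : ℕ) (s : Fin n → ℕ), ∀ j : ℕ,
    ∀ y : Fin n → ℝ, y ∈ (j : ℝ) • D.QQ l → (∀ k, ∃ z : ℤ, y k = z) →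
      ∃ z : Fin n → ℕ, cH n z = y ∧ z + s ∈ D.PP ((j + E) • l) := by
  classical
  obtain ⟨q0, hq0⟩ := D.PP_corner hl
  have hfin := D.PP_fin l
  set P : Finset (Fin n → ℕ) := hfin.toFinset with hP
  have hPm : ∀ q, q ∈ P ↔ q ∈ D.PP l := fun q => by simp [hP]
  set c : Fin n → ℕ := fun k => ∑ q ∈ P, q k + P.card * q0 k with hc
  set E := ∑ k, c k with hE
  refine ⟨E, fun k => (E + P.card) * q0 k, fun j y hy hz => ?_⟩
  obtain ⟨x, hx, rfl⟩ := hy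
  have hx' : x ∈ convexHull ℝ ((P.image (cH n) : Finset _) : Set (Fin n → ℝ)) := by
    rw [Finset.coe_image, hP, Set.Finite.coe_toFinset]; exact hx
  rw [Finset.mem_convexHull'] at hx'
  obtain ⟨w, hw0, hw1, hwx⟩ := hx'
  rw [Finset.sum_image (fun a _ b _ h => cH_inj n h)] at hw1 hwx
  set t : (Fin n → ℕ) → ℝ := fun q => j * w (cH n q) with ht
  have ht0 : ∀ q ∈ P, 0 ≤ t q := fun q hq =>
    mul_nonneg (by positivity) (hw0 _ (Finset.mem_image_of_mem _ hq))
  have hts : ∑ q ∈ P, t q = j := by rw [← Finset.mul_sum, hw1, mul_one]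
  have hty : ∀ k, ((j : ℝ) • x) k = ∑ q ∈ P, t q * (q k : ℝ) := by
    intro k
    rw [← hwx, Pi.smul_apply, Finset.sum_apply, smul_eq_mul, Finset.mul_sum]
    refine Finset.sum_congr rfl fun q _ => ?_
    simp [ht, cH_apply]; ring
  set a : (Fin n → ℕ) → ℕ := fun q => ⌊t q⌋₊ with ha
  have ha1 : ∀ q ∈ P, (a q : ℝ) ≤ t q := fun q hq => Nat.floor_le (ht0 q hq)
  have ha2 : ∀ q ∈ P, t q ≤ a q + 1 := fun q _ => (Nat.lt_floor_add_one _).le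
  have hal : ∑ q ∈ P, a q ≤ j := by
    have : ((∑ q ∈ P, a q : ℕ) : ℝ) ≤ j := by
      push_cast; rw [← hts]; exact Finset.sum_le_sum ha1
    exact_mod_cast this
  have hau : j ≤ ∑ q ∈ P, a q + P.card := by
    have : (j : ℝ) ≤ ((∑ q ∈ P, a q + P.card : ℕ) : ℝ) := by
      push_cast; rw [← hts]
      refine (Finset.sum_le_sum ha2).trans ?_
      rw [Finset.sum_add_distrib]; simp
    exact_mod_cast this
  choose zz hzz using hz
  have hb : ∀ k, ∃ b : ℕ, ((j : ℝ) • x) k = ((∑ q ∈ P, a q * q k : ℕ) : ℝ) + b ∧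
      b ≤ ∑ q ∈ P, q k := by
    intro k
    have h1 : ((∑ q ∈ P, a q * q k : ℕ) : ℝ) ≤ ((j : ℝ) • x) k := by
      rw [hty]; push_cast
      exact Finset.sum_le_sum fun q hq => mul_le_mul_of_nonneg_right (ha1 q hq) (by positivity)
    have h2 : ((j : ℝ) • x) k ≤ ((∑ q ∈ P, a q * q k : ℕ) : ℝ) + ((∑ q ∈ P, q k : ℕ) : ℝ) := by
      rw [hty]; push_cast
      rw [← Finset.sum_add_distrib]
      refine Finset.sum_le_sum fun q hq => ?_
      have := mul_le_mul_of_nonneg_right (ha2 q hq) (by positivity : (0 : ℝ) ≤ (q k : ℝ))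
      linarith
    have hz := hzz k
    dsimp only at hz h1 h2 ⊢
    rw [hz] at h1 h2 ⊢
    have h1' : ((∑ q ∈ P, a q * q k : ℕ) : ℤ) ≤ zz k := by exact_mod_cast h1
    have h2' : zz k ≤ ((∑ q ∈ P, a q * q k : ℕ) : ℤ) + ((∑ q ∈ P, q k : ℕ) : ℤ) := by
      exact_mod_cast h2
    refine ⟨(zz k - ((∑ q ∈ P, a q * q k : ℕ) : ℤ)).toNat, ?_, by omega⟩
    have h3 := Int.toNat_of_nonneg (sub_nonneg.2 h1')
    have h4 : zz k = ((∑ q ∈ P, a q * q k : ℕ) : ℤ) +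
      (((zz k - ((∑ q ∈ P, a q * q k : ℕ) : ℤ)).toNat : ℕ) : ℤ) := by omega
    exact_mod_cast congrArg (fun z : ℤ => (z : ℝ)) h4
  choose b hb1 hb2 using hb
  obtain ⟨f, hf⟩ := Nat.exists_eq_add_of_le hal
  have hfP : f ≤ P.card := by omega
  obtain ⟨g, hg⟩ := Nat.exists_eq_add_of_le hfP
  refine ⟨fun k => ∑ q ∈ P, a q * q k + b k, ?_, ?_⟩
  · ext k
    rw [cH_apply]
    have := hb1 k
    dsimp only at this ⊢
    rw [this]; push_cast; ring
  · have m1 := D.PP_summem P (fun q hq => (hPm q).1 hq) a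
    have m2 := hq0 (E + f) (fun k => b k + g * q0 k) (by
      refine le_trans ?_ (Nat.le_add_right E f)
      rw [hE]
      refine Finset.sum_le_sum fun k _ => ?_
      rw [hc]
      have := Nat.mul_le_mul_right (q0 k) (by omega : g ≤ P.card)
      have := hb2 k
      dsimp only
      omega)
    have e : j + E = ∑ q ∈ P, a q + (E + f) := by omega
    rw [e, PP_addn]
    refine ⟨_, m1, _, m2, ?_⟩
    ext k
    simp only [Pi.add_apply]
    rw [hg]; ring

theorem QQ_compact (l : Multiset ι) : IsCompact (D.QQ l) :=
  ((D.PP_fin l).image _).isCompact_convexHull ℝ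

theorem p_eq_vol [Finite ι] {l : Multiset ι} (hl : l ≠ 0) :
    D.p n 0 l = volume.real (D.QQ l) := by
  have hcv : Convex ℝ (D.QQ l) := convex_convexHull ℝ _
  have hlat := tendsto_card_div_pow_atTop_volume (D.QQ l) (D.QQ_compact l).isBounded
    (D.QQ_compact l).measurableSet (Convex.addHaar_frontier volume hcv)
  rw [Fintype.card_fin] at hlat
  have hd := D.d_lim hl (μ := 0) (r := n) (by simp)
  simp only [d_zero] at hd
  set Λ := Submodule.span ℤ (Set.range (Pi.basisFun ℝ (Fin n))) with hΛ
  have hmem : ∀ x : Fin n → ℝ, x ∈ Λ ↔ ∀ k, ∃ z : ℤ, x k = z := by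
    intro x
    rw [hΛ, Module.Basis.mem_span_iff_repr_mem]
    simp [eq_comm]
  obtain ⟨E, s, hEs⟩ := D.QQ_decomp hl
  have hmap : ∀ j : ℕ, 0 < j → ∀ x : Fin n → ℝ, x ∈ D.QQ l ∩ (j : ℝ)⁻¹ • (Λ : Set (Fin n → ℝ)) →
      ∃ z : Fin n → ℕ, cH n z = (j : ℝ) • x ∧ z + s ∈ D.PP ((j + E) • l) := by
    rintro j hj x ⟨hx, y, hy, rfl⟩
    have hj' : (j : ℝ) ≠ 0 := by positivity
    refine hEs j _ (Set.smul_mem_smul_set hx) ?_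
    dsimp only
    rw [smul_inv_smul₀ hj']
    exact (hmem y).1 hy
  choose! φ hφ1 hφ2 using hmap
  have hinj : ∀ j : ℕ, 0 < j → Set.InjOn (fun x => φ j x + s)
      (D.QQ l ∩ (j : ℝ)⁻¹ • (Λ : Set (Fin n → ℝ))) := by
    intro j hj x hx y hy h
    have hj' : (j : ℝ) ≠ 0 := by positivity
    have h1 : φ j x = φ j y := add_right_cancel h
    have h2 := hφ1 j hj x hx
    rw [h1, hφ1 j hj y hy] at h2
    exact (smul_right_injective _ hj' h2).symm
  apply le_antisymm
  · refine le_of_tendsto_of_tendsto hd hlat ?_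
    filter_upwards [eventually_gt_atTop 0] with j hj
    have hj' : (j : ℝ) ≠ 0 := by positivity
    gcongr
    change _ ≤ (D.QQ l ∩ (j : ℝ)⁻¹ • (Λ : Set (Fin n → ℝ))).ncard
    refine Set.ncard_le_ncard_of_injOn (fun z => (j : ℝ)⁻¹ • cH n z) ?_ ?_ ?_
    · intro z hz
      refine ⟨?_, Set.smul_mem_smul_set ?_⟩
      · obtain ⟨x, hx, hxe⟩ := D.PP_sub l j ⟨z, hz, rfl⟩
        dsimp only at hxe ⊢
        rw [← hxe, inv_smul_smul₀ hj']; exact hx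
      · exact (hmem _).2 fun k => ⟨z k, by simp [cH_apply]⟩
    · intro x _ y _ h
      exact cH_inj n (smul_right_injective _ (inv_ne_zero hj') h)
    · exact Set.Finite.of_injOn (t := D.PP ((j + E) • l)) (fun x hx => hφ2 j hj x hx)
        (hinj j hj) (D.PP_fin _)
  · refine le_of_tendsto_of_tendsto hlat (shift_lim' n _ _ hd E) ?_
    filter_upwards [eventually_gt_atTop 0] with j hj
    gcongr
    change (D.QQ l ∩ (j : ℝ)⁻¹ • (Λ : Set (Fin n → ℝ))).ncard ≤ _
    exact Set.ncard_le_ncard_of_injOn (fun x => φ j x + s) (fun x hx => hφ2 j hj x hx)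
      (hinj j hj) (D.PP_fin _)

theorem QQ_sum (l : Multiset ι) :
    D.QQ l = (l.map fun i => convexHull ℝ (cH n '' (D.S i : Set (Fin n → ℕ)))).sum := by
  unfold QQ PP
  rw [Set.image_multiset_sum, convexHull_multiset_sum, Multiset.map_map, Multiset.map_map]
  rfl

/-- the polytopes in Euclidean space -/
noncomputable def poly (i : ι) : Set (En n) :=
  (WithLp.linearEquiv 2 ℝ (Fin n → ℝ)).symm '' convexHull ℝ (cH n '' (D.S i : Set (Fin n → ℕ)))

theorem vol_poly [Finite ι] {σ : Type} (φ : σ → ι) (s : Finset σ) (hs : s.Nonempty) :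
    (volume (∑ i ∈ s, D.poly (φ i))).toReal = D.p n 0 (s.val.map φ) := by
  rw [D.p_eq_vol (by simpa using hs.ne_empty), QQ_sum]
  unfold poly
  rw [← Set.image_finsetSum, Measure.real]
  congr 1
  rw [Multiset.map_map]
  rw [← (EuclideanSpace.volume_preserving_symm_measurableEquiv_toLp (Fin n)).measure_preimage_equiv]
  congr 1
  exact Equiv.image_eq_preimage_symm (WithLp.linearEquiv 2 ℝ (Fin n → ℝ)).symm.toEquiv _

end Setup
end ConvexPaper

namespace ConvexPaper
open Filter Topology

theorem incl_excl {n : ℕ} {t : Finset ℕ} (ht : t ⊆ Finset.range n) :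
    ∑ S ∈ (Finset.range n).powerset.filter (fun S => t ⊆ S), (-1 : ℝ) ^ (n - S.card) =
      if t = Finset.range n then 1 else 0 := by
  have h1 : ∑ S ∈ (Finset.range n).powerset.filter (fun S => t ⊆ S), (-1 : ℝ) ^ (n - S.card) =
      ∑ U ∈ (Finset.range n \ t).powerset, (-1 : ℝ) ^ U.card := by
    refine Finset.sum_bij' (fun S _ => Finset.range n \ S) (fun U _ => Finset.range n \ U)
      ?_ ?_ ?_ ?_ ?_
    · intro S hS
      simp only [Finset.mem_filter, Finset.mem_powerset] at hS ⊢
      exact Finset.sdiff_subset_sdiff le_rfl hS.2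
    · intro U hU
      simp only [Finset.mem_filter, Finset.mem_powerset] at hU ⊢
      refine ⟨Finset.sdiff_subset, fun x hx => ?_⟩
      rw [Finset.mem_sdiff]
      refine ⟨ht hx, fun h => ?_⟩
      exact (Finset.mem_sdiff.1 (hU h)).2 hx
    · intro S hS
      simp only [Finset.mem_filter, Finset.mem_powerset] at hS
      simp [Finset.inter_eq_right.2 hS.1]
    · intro U hU
      simp only [Finset.mem_powerset] at hU
      simp [Finset.inter_eq_right.2 (hU.trans Finset.sdiff_subset)]
    · intro S hS
      simp only [Finset.mem_filter, Finset.mem_powerset] at hS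
      rw [Finset.card_sdiff_of_subset hS.1, Finset.card_range]
  rw [h1]
  have h2 := Finset.sum_powerset_neg_one_pow_card (x := Finset.range n \ t)
  have h3 := congrArg (fun z : ℤ => (z : ℝ)) h2
  push_cast at h3
  rw [h3]
  have : Finset.range n \ t = ∅ ↔ t = Finset.range n := by
    rw [Finset.sdiff_eq_empty_iff_subset]
    exact ⟨fun h => ht.antisymm h, fun h => h.ge⟩
  simp [this]

theorem card_surj (n : ℕ) :
    ((Fintype.piFinset fun _ : Fin n => Finset.range n).filter
      (fun χ => Finset.univ.image χ = Finset.range n)).card = n.factorial := by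
  rw [← Fintype.card_fin n, ← Fintype.card_perm, Fintype.card_fin, ← Finset.card_univ, eq_comm]
  refine Finset.card_bij (fun σ _ a => ((σ a : Fin n) : ℕ)) ?_ ?_ ?_
  · intro σ _
    simp only [Finset.mem_filter, Fintype.mem_piFinset, Finset.mem_range]
    refine ⟨fun a => (σ a).2, ?_⟩
    ext x
    simp only [Finset.mem_image, Finset.mem_univ, true_and, Finset.mem_range]
    constructor
    · rintro ⟨a, rfl⟩; exact (σ a).2
    · intro h; exact ⟨σ.symm ⟨x, h⟩, by simp⟩
  · intro σ _ τ _ h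
    ext a
    exact congrFun h a
  · intro χ hχ
    simp only [Finset.mem_filter, Fintype.mem_piFinset, Finset.mem_range] at hχ
    have hs : Function.Surjective (fun a : Fin n => (⟨χ a, hχ.1 a⟩ : Fin n)) := by
      intro b
      have : (b : ℕ) ∈ Finset.univ.image χ := by rw [hχ.2]; simp
      obtain ⟨a, -, ha⟩ := Finset.mem_image.1 this
      exact ⟨a, Fin.ext ha⟩
    exact ⟨Equiv.ofBijective _ ((Finite.injective_iff_bijective).1
      (Finite.injective_iff_surjective.2 hs)), Finset.mem_univ _, rfl⟩

theorem surj_map {n : ℕ} {χ : Fin n → ℕ} (h : Finset.univ.image χ = Finset.range n) :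
    (Finset.univ.val.map χ) = Multiset.range n := by
  have hinj : Set.InjOn χ (Finset.univ : Finset (Fin n)) := by
    rw [← Finset.card_image_iff, h]; simp
  rw [← Finset.image_val_of_injOn hinj, h]; rfl

namespace Setup
variable {n : ℕ} {ι : Type} [DecidableEq ι] {L : Type} [Field L] [Algebra ℚ L] (D : Setup n ι L)
set_option linter.unusedSectionVars false

theorem mixedVol_poly [Finite ι] (hn : 0 < n) (φ : ℕ → ι) (M : List (Set (En n)))
    (h : ∀ i < n, M.getD i 0 = D.poly (φ i)) :
    mixedVol n M = (D.N ((Multiset.range n).map φ) : ℝ) / n.factorial := by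
  have hf : (n.factorial : ℝ) ≠ 0 := by positivity
  rw [mixedVol]
  have h1 : ∀ S ∈ (Finset.range n).powerset.filter (fun S => S.Nonempty),
      (-1 : ℝ) ^ (n - S.card) * (volume (∑ i ∈ S, M.getD i 0)).toReal =
      (n.factorial : ℝ)⁻¹ * ∑ χ ∈ Fintype.piFinset (fun _ : Fin n => S),
        (-1 : ℝ) ^ (n - S.card) * (D.N (Finset.univ.val.map fun a => φ (χ a)) : ℝ) := by
    intro S hS
    simp only [Finset.mem_filter, Finset.mem_powerset] at hS
    rw [Finset.sum_congr rfl fun i hi => h i (Finset.mem_range.1 (hS.1 hi)), D.vol_poly φ S hS.2,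
      ← Finset.mul_sum]
    have := D.p_formula φ S n 0
    simp only [zero_add] at this
    rw [← this]
    field_simp
  rw [Finset.sum_congr rfl h1, ← Finset.mul_sum]
  rw [Finset.sum_comm' (t' := Fintype.piFinset fun _ : Fin n => Finset.range n)
    (s' := fun χ => (Finset.range n).powerset.filter (fun S => Finset.univ.image χ ⊆ S))]
  · have h2 : ∀ χ ∈ Fintype.piFinset (fun _ : Fin n => Finset.range n),
        ∑ S ∈ (Finset.range n).powerset.filter (fun S => Finset.univ.image χ ⊆ S),
          (-1 : ℝ) ^ (n - S.card) * (D.N (Finset.univ.val.map fun a => φ (χ a)) : ℝ) =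
        if Finset.univ.image χ = Finset.range n then
          (D.N ((Multiset.range n).map φ) : ℝ) else 0 := by
      intro χ hχ
      rw [← Finset.sum_mul, incl_excl]
      · split_ifs with hc
        · rw [one_mul, ← surj_map hc, Multiset.map_map]; rfl
        · simp
      · intro x hx
        obtain ⟨a, -, rfl⟩ := Finset.mem_image.1 hx
        exact Fintype.mem_piFinset.1 hχ a
    rw [Finset.sum_congr rfl h2, ← Finset.sum_filter, Finset.sum_const, card_surj, nsmul_eq_mul]
    field_simp
  · intro S χ
    simp only [Finset.mem_filter, Finset.mem_powerset, Fintype.mem_piFinset, Finset.image_subset_iff,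
      Finset.mem_univ, true_imp_iff]
    constructor
    · rintro ⟨⟨h1, h2⟩, h3⟩
      exact ⟨⟨h1, h3⟩, fun a => h1 (h3 a)⟩
    · rintro ⟨⟨h1, h2⟩, h3⟩
      exact ⟨⟨h1, ⟨_, h2 ⟨0, hn⟩⟩⟩, h2⟩

theorem mixedVol_list [Finite ι] (hn : 0 < n) (l : List ι) (hl : l.length = n) :
    mixedVol n (l.map D.poly) = (D.N (l : Multiset ι) : ℝ) / n.factorial := by
  have i0 : ι := l.get ⟨0, by omega⟩
  rw [D.mixedVol_poly hn (fun i => l.getD i i0)]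
  · congr 3
    change ((List.map (fun i => l.getD i i0) (List.range n) : List ι) : Multiset ι) = _
    congr 1
    refine List.ext_getElem (by simp [hl]) fun i h1 h2 => ?_
    simp [h2]
  · intro i hi
    simp [List.getD_eq_getElem, hl, hi]

theorem vol_single [Finite ι] (i : ι) :
    (volume (D.poly i)).toReal = (D.N (Multiset.replicate n i) : ℝ) / n.factorial := by
  have := D.vol_poly (fun _ : Unit => i) {()} (by simp)
  simp only [Finset.sum_singleton, Finset.singleton_val, Multiset.map_singleton] at this
  rw [this, p_single, zero_add]

theorem enum_union {μ ν : Multiset ι} (h : Disjoint μ ν) :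
    (μ + ν).toEnumFinset = μ.toEnumFinset ∪ ν.toEnumFinset := by
  ext ⟨a, k⟩
  simp only [Multiset.mem_toEnumFinset, Finset.mem_union, Multiset.count_add]
  by_cases ha : a ∈ μ
  · have := Multiset.count_eq_zero.2 (Multiset.disjoint_left.1 h ha)
    omega
  · have := Multiset.count_eq_zero.2 ha
    omega

theorem enum_disj {μ ν : Multiset ι} (h : Disjoint μ ν) :
    Disjoint μ.toEnumFinset ν.toEnumFinset := by
  rw [Finset.disjoint_left]
  rintro ⟨a, k⟩ h1 h2
  rw [Multiset.mem_toEnumFinset] at h1 h2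
  dsimp only at h1 h2
  have h3 : a ∈ μ := Multiset.count_pos.1 (by omega)
  exact Multiset.disjoint_left.1 h h3 (Multiset.count_pos.1 (by omega))

theorem N_ineq [Finite ι] (B : ι) (X I J : Multiset ι) (hI : Disjoint I (X + J))
    (hJ : Disjoint X J) (hc : X.card + I.card + J.card = n) :
    (D.N (X + Multiset.replicate (I.card + J.card) B) : ℝ) / (I.card + J.card).factorial *
      D.N (I + (X + J)) ≤
    (D.N (I + X + Multiset.replicate J.card B) : ℝ) / J.card.factorial *
      (D.N (X + J + Multiset.replicate I.card B) / I.card.factorial) := by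
  have hIX : Disjoint I X := by
    rw [Multiset.disjoint_left] at hI ⊢
    intro a ha hx; exact hI ha (Multiset.mem_add.2 (Or.inl hx))
  obtain ⟨e, he⟩ := D.d_single_ge (μ := I + (X + J))
    (by rw [Multiset.card_add, Multiset.card_add]; omega) B
  have key : ∀ j : ℕ, D.d X (j • {B}) * D.N (I + (X + J)) ≤
      D.d (I + X) (j • {B}) * D.d (X + J) ((j + e) • {B}) := by
    intro j
    have := D.main_ineq (T := X.toEnumFinset) (T' := (X + J).toEnumFinset)
      (Multiset.toEnumFinset_mono (Multiset.le_add_right _ _)) I.toEnumFinset (enum_disj hI)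
      (by rw [← enum_union hI, Multiset.card_toEnumFinset, Multiset.card_add, Multiset.card_add]
          omega) (j • {B}) (e • {B})
    rw [← enum_union hI, ← enum_union hIX, ← add_nsmul] at this
    rw [← he e le_rfl]
    exact this
  have hB : ({B} : Multiset ι) ≠ 0 := by simp
  have l1 := D.d_lim hB (μ := X) (r := I.card + J.card) (by omega)
  have l2 := D.d_lim hB (μ := I + X) (r := J.card) (by rw [Multiset.card_add]; omega)
  have l3 := shift_lim' _ _ _ (D.d_lim hB (μ := X + J) (r := I.card)
    (by rw [Multiset.card_add]; omega)) e
  rw [p_single] at l1 l2 l3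
  refine le_of_tendsto_of_tendsto (l1.mul_const (D.N (I + (X + J)) : ℝ)) (l2.mul l3) ?_
  filter_upwards [eventually_gt_atTop 0] with j hj
  have hj' : (0 : ℝ) < j := by exact_mod_cast hj
  have h1 : ((D.d X (j • {B}) * D.N (I + (X + J)) : ℕ) : ℝ) ≤
      ((D.d (I + X) (j • {B}) * D.d (X + J) ((j + e) • {B}) : ℕ) : ℝ) := by
    exact_mod_cast key j
  push_cast at h1
  rw [div_mul_div_comm, div_mul_eq_mul_div, ← pow_add, add_comm J.card]
  gcongr

end Setup

/-- the inequality, for a family of sets -/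
def Ineq (n m k : ℕ) (hk : k ≤ m) (K : Option (Fin m) → Set (En n)) : Prop :=
  (volume (K none)).toReal *
      mixedVol n (List.replicate (n - m) (K none) ++ List.ofFn fun i => K (some i)) ≤
    (m.factorial : ℝ) / (k.factorial * (m - k).factorial) *
      (mixedVol n (List.replicate (n - k) (K none) ++
          List.ofFn fun i : Fin k => K (some (Fin.castLE hk i))) *
       mixedVol n (List.replicate (n - m + k) (K none) ++
          List.ofFn fun i : Fin (m - k) => K (some ⟨k + (i : ℕ), by omega⟩)))

theorem ofFn_split {α : Type} {m k : ℕ} (hk : k ≤ m) (f : Fin m → α) :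
    List.ofFn f = (List.ofFn fun i : Fin k => f (Fin.castLE hk i)) ++
      List.ofFn fun i : Fin (m - k) => f ⟨k + (i : ℕ), by omega⟩ := by
  refine List.ext_getElem (by simp; omega) fun i h1 h2 => ?_
  rw [List.getElem_append]
  split_ifs with h
  · simp
  · simp at h ⊢
    congr 2
    omega

theorem ineq_lattice (n m k : ℕ) (hn : 0 < n) (hk : k ≤ m) (hm : m ≤ n)
    (S : Option (Fin m) → Finset (Fin n → ℕ)) (b0 : Option (Fin m) → Fin n → ℕ)
    (hb0 : ∀ i, b0 i ∈ S i) (hb1 : ∀ i j, b0 i + Pi.single j 1 ∈ S i) :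
    Ineq n m k hk (fun i => (WithLp.linearEquiv 2 ℝ (Fin n → ℝ)).symm ''
      convexHull ℝ (cH n '' (S i : Set (Fin n → ℕ)))) := by
  obtain ⟨L, _, _, D, rfl⟩ := exists_setup n (Option (Fin m)) S b0 hb0 hb1
  change Ineq n m k hk D.poly
  let X := List.replicate (n - m) (none : Option (Fin m))
  let I : List (Option (Fin m)) := List.ofFn fun i : Fin k => some (Fin.castLE hk i)
  let J : List (Option (Fin m)) :=
    List.ofFn fun i : Fin (m - k) => some (⟨k + (i : ℕ), by omega⟩ : Fin m)
  have lX : X.length = n - m := by simp [X]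
  have lI : I.length = k := by simp [I]
  have lJ : J.length = m - k := by simp [J]
  have hJ : Disjoint (X : Multiset (Option (Fin m))) J := by
    rw [Multiset.disjoint_left]
    intro a h1 h2
    simp [X, J] at h1 h2
    obtain ⟨i, rfl⟩ := h2
    simp at h1
  have hI : Disjoint (I : Multiset (Option (Fin m))) (X + J) := by
    rw [Multiset.disjoint_left]
    intro a h1 h2
    simp [X, J, I] at h1 h2
    obtain ⟨i, rfl⟩ := h1
    rcases h2 with h2 | ⟨i', h2⟩
    · simp at h2
    · simp [Fin.ext_iff] at h2
      omega
  have key := D.N_ineq none X I J hI hJ (by simp [lX, lI, lJ]; omega)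
  simp only [Multiset.coe_card, lX, lI, lJ] at key
  rw [show k + (m - k) = m by omega] at key
  have e0 : List.replicate (n - m) (D.poly none) ++ (List.ofFn fun i => D.poly (some i)) =
      (X ++ (I ++ J)).map D.poly := by
    rw [ofFn_split hk]
    simp [X, I, J, List.map_ofFn, Function.comp_def]
  have e1 : List.replicate (n - k) (D.poly none) ++
      (List.ofFn fun i : Fin k => D.poly (some (Fin.castLE hk i))) =
      (List.replicate (n - k) none ++ I).map D.poly := by
    simp [I, List.map_ofFn, Function.comp_def]
  have e2 : List.replicate (n - m + k) (D.poly none) ++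
      (List.ofFn fun i : Fin (m - k) => D.poly (some (⟨k + (i : ℕ), by omega⟩ : Fin m))) =
      (List.replicate (n - m + k) none ++ J).map D.poly := by
    simp [J, List.map_ofFn, Function.comp_def]
  rw [Ineq, e0, e1, e2, D.vol_single, D.mixedVol_list hn _ (by simp [lX, lI, lJ]; omega),
    D.mixedVol_list hn _ (by simp [lI]; omega), D.mixedVol_list hn _ (by simp [lJ]; omega)]
  have f1 : ((X : Multiset (Option (Fin m))) + Multiset.replicate m none) =
      Multiset.replicate n none := by
    rw [show (X : Multiset (Option (Fin m))) = Multiset.replicate (n - m) none from rfl,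
      ← Multiset.replicate_add, Nat.sub_add_cancel hm]
  have f2 : ((I : Multiset (Option (Fin m))) + ((X : Multiset (Option (Fin m))) + (J : Multiset (Option (Fin m))))) =
      ((X ++ (I ++ J) : List (Option (Fin m))) : Multiset (Option (Fin m))) := by
    rw [← Multiset.coe_add, ← Multiset.coe_add]; abel
  have f3 : ((I : Multiset (Option (Fin m))) + (X : Multiset (Option (Fin m))) + Multiset.replicate (m - k) none) =
      ((List.replicate (n - k) none ++ I : List (Option (Fin m))) : Multiset (Option (Fin m))) := by
    rw [← Multiset.coe_add, show (X : Multiset (Option (Fin m))) = Multiset.replicate (n - m) none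
      from rfl, add_assoc, ← Multiset.replicate_add, add_comm, show n - m + (m - k) = n - k by omega]
    rfl
  have f4 : ((X : Multiset (Option (Fin m))) + (J : Multiset (Option (Fin m))) + Multiset.replicate k none) =
      ((List.replicate (n - m + k) none ++ J : List (Option (Fin m))) : Multiset (Option (Fin m))) := by
    rw [← Multiset.coe_add, show (X : Multiset (Option (Fin m))) = Multiset.replicate (n - m) none
      from rfl, add_right_comm, ← Multiset.replicate_add]
    rfl
  rw [f1, f2, f3, f4] at key
  generalize (D.N (Multiset.replicate n none) : ℝ) = a at *
  generalize (D.N ((X ++ (I ++ J) : List (Option (Fin m))) : Multiset (Option (Fin m))) : ℝ) = b at *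
  generalize (D.N ((List.replicate (n - k) none ++ I : List (Option (Fin m))) : Multiset (Option (Fin m))) : ℝ) = c at *
  generalize (D.N ((List.replicate (n - m + k) none ++ J : List (Option (Fin m))) : Multiset (Option (Fin m))) : ℝ) = d at *
  have hF : (0 : ℝ) < n.factorial := by positivity
  have hm' : (0 : ℝ) < m.factorial := by positivity
  have := mul_le_mul_of_nonneg_left key
    (by positivity : (0 : ℝ) ≤ (m.factorial : ℝ) / ((n.factorial : ℝ) * n.factorial))
  calc a / n.factorial * (b / n.factorial)
      = (m.factorial : ℝ) / ((n.factorial : ℝ) * n.factorial) * (a / m.factorial * b) := by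
        field_simp
    _ ≤ _ := this
    _ = _ := by field_simp

end ConvexPaper

namespace ConvexPaper
open Filter Topology

/-- the three type lists -/
def l0 (n m : ℕ) : List (Option (Fin m)) := List.replicate (n - m) none ++ List.ofFn some
def l1 (n m k : ℕ) (hk : k ≤ m) : List (Option (Fin m)) :=
  List.replicate (n - k) none ++ List.ofFn fun i : Fin k => some (Fin.castLE hk i)
def l2 (n m k : ℕ) : List (Option (Fin m)) :=
  List.replicate (n - m + k) none ++
    List.ofFn fun i : Fin (m - k) => some (⟨k + (i : ℕ), by omega⟩ : Fin m)

theorem Ineq_iff (n m k : ℕ) (hk : k ≤ m) (K : Option (Fin m) → Set (En n)) :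
    Ineq n m k hk K ↔ (volume (K none)).toReal * mixedVol n ((l0 n m).map K) ≤
      (m.factorial : ℝ) / (k.factorial * (m - k).factorial) *
        (mixedVol n ((l1 n m k hk).map K) * mixedVol n ((l2 n m k).map K)) := by
  simp [Ineq, l0, l1, l2, List.map_ofFn, Function.comp_def]

theorem vol_aff {n : ℕ} (c : ℝ) (hc : 0 < c) (X : Set (En n)) (w : En n) :
    (volume (c • X + {w})).toReal = c ^ n * (volume X).toReal := by
  rw [Set.add_singleton, Set.image_add_right, measure_preimage_add_right,
    Measure.addHaar_smul_of_nonneg _ hc.le, ENNReal.toReal_mul, ENNReal.toReal_ofReal (by positivity)]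
  simp

theorem mixedVol_aff {n : ℕ} {ι : Type} (P : ι → Set (En n)) (c : ℝ) (hc : 0 < c) (v : ι → En n)
    (l : List ι) :
    mixedVol n (l.map fun i => c • P i + {v i}) = c ^ n * mixedVol n (l.map P) := by
  have h : ∀ i : ℕ, ∃ w : En n, (l.map fun i => c • P i + {v i}).getD i 0 =
      c • (l.map P).getD i 0 + {w} := by
    intro i
    by_cases hi : i < l.length
    · exact ⟨v l[i], by simp [hi]⟩
    · exact ⟨0, by simp [hi]; rfl⟩
  choose w hw using h
  rw [mixedVol, mixedVol, mul_left_comm, Finset.mul_sum (a := c ^ n)]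
  congr 1
  refine Finset.sum_congr rfl fun S hS => ?_
  clear hS
  have : ∑ i ∈ S, (l.map fun i => c • P i + {v i}).getD i 0 =
      c • (∑ i ∈ S, (l.map P).getD i 0) + {∑ i ∈ S, w i} := by
    induction S using Finset.induction_on with
    | empty => simp; rfl
    | insert a s ha ih =>
      rw [Finset.sum_insert ha, Finset.sum_insert ha, Finset.sum_insert ha, ih, hw, smul_add,
        ← Set.singleton_add_singleton]
      abel
  rw [this, vol_aff c hc]
  ring

theorem Ineq_aff (n m k : ℕ) (hk : k ≤ m) (P : Option (Fin m) → Set (En n)) (c : ℝ) (hc : 0 < c)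
    (v : Option (Fin m) → En n) (h : Ineq n m k hk P) :
    Ineq n m k hk (fun i => c • P i + {v i}) := by
  rw [Ineq_iff] at h ⊢
  rw [mixedVol_aff P c hc v, mixedVol_aff P c hc v, mixedVol_aff P c hc v, vol_aff c hc]
  have := mul_le_mul_of_nonneg_left h (by positivity : 0 ≤ c ^ n * c ^ n)
  linarith

theorem sum_sub {n : ℕ} (S : Finset ℕ) (F G : ℕ → Set (En n)) (δ : ℝ) (hδ : 0 ≤ δ)
    (hF : ∀ i, IsCompact (F i)) (h : ∀ i, G i ⊆ Metric.cthickening δ (F i)) :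
    ∑ i ∈ S, G i ⊆ Metric.cthickening (S.card * δ) (∑ i ∈ S, F i) ∧ IsCompact (∑ i ∈ S, F i) := by
  induction S using Finset.induction_on with
  | empty => 
    simp only [Finset.sum_empty, Finset.card_empty]
    exact ⟨Metric.self_subset_cthickening _, isCompact_singleton⟩
  | insert a s ha ih =>
    obtain ⟨ih1, ih2⟩ := ih
    rw [Finset.sum_insert ha, Finset.sum_insert ha, Finset.card_insert_of_notMem ha]
    have hc : IsCompact (F a + ∑ i ∈ s, F i) := (hF a).add ih2
    refine ⟨?_, hc⟩
    rw [← hc.add_closedBall_zero (by positivity)]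
    rw [← ih2.add_closedBall_zero (by positivity)] at ih1
    have h1 := h a
    rw [← (hF a).add_closedBall_zero hδ] at h1
    refine (Set.add_subset_add h1 ih1).trans ?_
    rw [add_add_add_comm]
    refine Set.add_subset_add le_rfl ?_
    rintro _ ⟨x, hx, y, hy, rfl⟩
    rw [mem_closedBall_zero_iff] at *
    push_cast
    linarith [norm_add_le x y]

theorem vol_lim {n : ℕ} (S : Finset ℕ) (F : ℕ → Set (En n)) (G : ℕ → ℕ → Set (En n)) (δ : ℕ → ℝ)
    (hδ : ∀ N, 0 ≤ δ N) (hδ0 : Tendsto δ atTop (𝓝 0))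
    (hF : ∀ i, IsCompact (F i)) (h1 : ∀ N i, F i ⊆ G N i)
    (h : ∀ N i, G N i ⊆ Metric.cthickening (δ N) (F i)) :
    Tendsto (fun N => (volume (∑ i ∈ S, G N i)).toReal) atTop
      (𝓝 (volume (∑ i ∈ S, F i)).toReal) := by
  have hc := (sum_sub S F (G 0) (δ 0) (hδ 0) hF (h 0)).2
  have h2 : Tendsto (fun N => volume (Metric.cthickening (S.card * δ N) (∑ i ∈ S, F i))) atTop
      (𝓝 (volume (∑ i ∈ S, F i))) := by
    have h3 := tendsto_measure_cthickening_of_isCompact (μ := (volume : Measure (En n))) hc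
    refine h3.comp ?_
    simpa using hδ0.const_mul (S.card : ℝ)
  refine (ENNReal.tendsto_toReal hc.measure_lt_top.ne).comp ?_
  refine tendsto_of_tendsto_of_tendsto_of_le_of_le tendsto_const_nhds h2 (fun N => ?_) fun N => ?_
  · exact measure_mono (Set.finsetSum_subset_finsetSum _ _ _ fun i _ => h1 N i)
  · exact measure_mono (sum_sub S F (G N) (δ N) (hδ N) hF (h N)).1

theorem mixedVol_lim {n : ℕ} {ι : Type} (K : ι → Set (En n)) (G : ℕ → ι → Set (En n)) (δ : ℕ → ℝ)
    (hδ : ∀ N, 0 ≤ δ N) (hδ0 : Tendsto δ atTop (𝓝 0))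
    (hF : ∀ i, IsCompact (K i)) (h1 : ∀ N i, K i ⊆ G N i)
    (h : ∀ N i, G N i ⊆ Metric.cthickening (δ N) (K i)) (l : List ι) :
    Tendsto (fun N => mixedVol n (l.map (G N))) atTop (𝓝 (mixedVol n (l.map K))) := by
  unfold mixedVol
  refine Tendsto.const_mul _ (tendsto_finsetSum _ fun S _ => Tendsto.const_mul _ ?_)
  refine vol_lim S _ (fun N i => (l.map (G N)).getD i 0) δ hδ hδ0 ?_ ?_ ?_
  · intro i
    by_cases hi : i < l.length
    · simpa [hi] using hF _
    · simp [hi]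
  · intro N i
    by_cases hi : i < l.length
    · simpa [hi] using h1 N _
    · simp [hi]
  · intro N i
    by_cases hi : i < l.length
    · simpa [hi] using h N _
    · simp only [hi, List.getD_eq_getElem?_getD, List.getElem?_map, not_false_eq_true,
        List.getElem?_eq_none (not_lt.1 hi), Option.map_none, Option.getD_none]
      exact Metric.self_subset_cthickening _

theorem Ineq_lim (n m k : ℕ) (hk : k ≤ m) (K : Option (Fin m) → Set (En n))
    (G : ℕ → Option (Fin m) → Set (En n)) (δ : ℕ → ℝ)
    (hδ : ∀ N, 0 ≤ δ N) (hδ0 : Tendsto δ atTop (𝓝 0))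
    (hF : ∀ i, IsCompact (K i)) (h1 : ∀ N i, K i ⊆ G N i)
    (h : ∀ N i, G N i ⊆ Metric.cthickening (δ N) (K i)) (hI : ∀ N, Ineq n m k hk (G N)) :
    Ineq n m k hk K := by
  simp only [Ineq_iff] at hI ⊢
  have hm := mixedVol_lim K G δ hδ hδ0 hF h1 h
  have hv := vol_lim {0} (fun _ => K none) (fun N _ => G N none) δ hδ hδ0 (fun _ => hF _)
    (fun N _ => h1 N _) (fun N _ => h N _)
  simp only [Finset.sum_singleton] at hv
  exact le_of_tendsto_of_tendsto' (hv.mul (hm _)) (((hm _).mul (hm _)).const_mul _) hI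

/-- lattice approximation -/
noncomputable def SS {n : ℕ} (K : Set (En n)) (M N : ℕ) : Finset (Fin n → ℕ) := by
  classical
  exact (Fintype.piFinset fun _ : Fin n => Finset.range (N * (2 * M) + 3)).filter
    fun z => ∃ x ∈ K, ∀ j, |(z j : ℝ) - N * (x j + M)| ≤ 2

theorem mem_SS {n : ℕ} {K : Set (En n)} {M N : ℕ} {z : Fin n → ℕ} :
    z ∈ SS K M N ↔ (∀ j, z j < N * (2 * M) + 3) ∧
      ∃ x ∈ K, ∀ j, |(z j : ℝ) - N * (x j + M)| ≤ 2 := by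
  simp [SS]

theorem SS_floor {n : ℕ} {K : Set (En n)} {M N : ℕ} (hM : ∀ x ∈ K, ∀ j, |x j| ≤ M) {x : En n}
    (hx : x ∈ K) {z : Fin n → ℕ} (hz : ∀ j, z j = ⌊(N : ℝ) * (x j + M)⌋₊ ∨
      z j = ⌊(N : ℝ) * (x j + M)⌋₊ + 1) : z ∈ SS K M N := by
  have h : ∀ j, (⌊(N : ℝ) * (x j + M)⌋₊ : ℝ) ≤ N * (x j + M) ∧
      (N : ℝ) * (x j + M) < ⌊(N : ℝ) * (x j + M)⌋₊ + 1 ∧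
      (N : ℝ) * (x j + M) ≤ (N * (2 * M) : ℕ) := by
    intro j
    have hj := abs_le.1 (hM x hx j)
    refine ⟨Nat.floor_le (mul_nonneg (by positivity) (by linarith)), Nat.lt_floor_add_one _, ?_⟩
    push_cast
    exact mul_le_mul_of_nonneg_left (by linarith) (by positivity)
  rw [mem_SS]
  refine ⟨fun j => ?_, x, hx, fun j => ?_⟩
  · obtain ⟨a, b, c⟩ := h j
    have : ⌊(N : ℝ) * (x j + M)⌋₊ ≤ N * (2 * M) := by exact_mod_cast a.trans c
    rcases hz j with e | e <;> omega
  · obtain ⟨a, b, c⟩ := h j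
    rw [abs_le]
    rcases hz j with e | e <;> rw [e] <;> push_cast <;> constructor <;> linarith

theorem SS_hull {n : ℕ} {K : Set (En n)} {M N : ℕ} (hM : ∀ x ∈ K, ∀ j, |x j| ≤ M) {x : En n}
    (hx : x ∈ K) : (fun j => (N : ℝ) * (x j + M)) ∈
      convexHull ℝ (cH n '' (SS K M N : Set (Fin n → ℕ))) := by
  have h1 : (Set.pi Set.univ fun j => ({(⌊(N : ℝ) * (x j + M)⌋₊ : ℝ),
      (⌊(N : ℝ) * (x j + M)⌋₊ : ℝ) + 1} : Set ℝ)) ⊆ cH n '' (SS K M N : Set (Fin n → ℕ)) := by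
    intro y hy
    have : ∀ j, ∃ z : ℕ, (z : ℝ) = y j ∧ (z = ⌊(N : ℝ) * (x j + M)⌋₊ ∨
      z = ⌊(N : ℝ) * (x j + M)⌋₊ + 1) := by
      intro j
      rcases hy j (Set.mem_univ _) with e | e
      · exact ⟨_, e.symm, Or.inl rfl⟩
      · rw [Set.mem_singleton_iff] at e
        exact ⟨⌊(N : ℝ) * (x j + M)⌋₊ + 1, by rw [e]; push_cast; rfl, Or.inr rfl⟩
    choose z hz1 hz2 using this
    exact ⟨z, SS_floor hM hx hz2, funext hz1⟩
  refine convexHull_mono h1 ?_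
  rw [convexHull_pi]
  intro j _
  dsimp only
  rw [convexHull_pair, segment_eq_Icc (by linarith)]
  have hj := abs_le.1 (hM x hx j)
  exact ⟨Nat.floor_le (mul_nonneg (by positivity) (by linarith)), (Nat.lt_floor_add_one _).le⟩

theorem ineq_body (n m k : ℕ) (hn : 0 < n) (hk : k ≤ m) (hm : m ≤ n)
    (K : Option (Fin m) → Set (En n)) (hc : ∀ i, IsCompact (K i)) (hv : ∀ i, Convex ℝ (K i))
    (hne : ∀ i, (K i).Nonempty) : Ineq n m k hk K := by
  have hM : ∃ M : ℕ, ∀ i, ∀ x ∈ K i, ∀ j, |x j| ≤ M := by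
    have : ∀ i, ∃ M : ℕ, ∀ x ∈ K i, ‖x‖ ≤ M := by
      intro i
      obtain ⟨C, hC⟩ := (hc i).isBounded.exists_norm_le
      obtain ⟨M, hM⟩ := exists_nat_ge C
      exact ⟨M, fun x hx => (hC x hx).trans hM⟩
    choose M hM using this
    refine ⟨Finset.univ.sup M, fun i x hx j => ?_⟩
    have h1 : ‖x j‖ ≤ ‖x‖ := PiLp.norm_apply_le x j
    rw [Real.norm_eq_abs] at h1
    refine (h1.trans (hM i x hx)).trans ?_
    exact_mod_cast Finset.le_sup (f := M) (Finset.mem_univ i)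
  obtain ⟨M, hM⟩ := hM
  choose x0 hx0 using hne
  let P : ℕ → Option (Fin m) → Set (En n) := fun N i => (WithLp.linearEquiv 2 ℝ (Fin n → ℝ)).symm ''
      convexHull ℝ (cH n '' (SS (K i) M (N + 1) : Set (Fin n → ℕ)))
  let v : En n := WithLp.toLp 2 fun _ => -(M : ℝ)
  let δ : ℕ → ℝ := fun N => 2 * n / ((N : ℝ) + 1)
  have hPI : ∀ N, Ineq n m k hk (P N) := fun N => by
    refine ineq_lattice n m k hn hk hm (fun i => SS (K i) M (N + 1))
      (fun i j => ⌊((N + 1 : ℕ) : ℝ) * (x0 i j + M)⌋₊) (fun i => ?_) (fun i j => ?_)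
    · exact SS_floor (hM i) (hx0 i) fun j => Or.inl rfl
    · refine SS_floor (hM i) (hx0 i) fun a => ?_
      by_cases ha : a = j
      · subst ha; simp
      · simp [ha]
  refine Ineq_lim n m k hk K (fun N i => ((N : ℝ) + 1)⁻¹ • P N i + {v}) δ (fun N => by positivity)
    ?_ hc ?_ ?_ fun N => Ineq_aff n m k hk (P N) _ (by positivity) (fun _ => v) (hPI N)
  · have := tendsto_one_div_add_atTop_nhds_zero_nat (𝕜 := ℝ)
    have := this.const_mul (2 * (n : ℝ))
    simpa [δ, div_eq_mul_inv] using this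
  · intro N i x hx
    have hN : ((N : ℝ) + 1) ≠ 0 := by positivity
    refine ⟨_, Set.smul_mem_smul_set ⟨_, SS_hull (N := N + 1) (hM i) hx, rfl⟩, v, rfl, ?_⟩
    ext j
    simp [v]
    field_simp
    ring
  · intro N i
    have hN : (0 : ℝ) < ((N : ℝ) + 1) := by positivity
    have hcv := (hv i).cthickening (δ N)
    let f : (Fin n → ℝ) →ᵃ[ℝ] En n :=
      ((((N : ℝ) + 1)⁻¹ • (WithLp.linearEquiv 2 ℝ (Fin n → ℝ)).symm.toLinearMap).toAffineMap) +
        AffineMap.const ℝ _ v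
    have hf : ∀ y, f y = ((N : ℝ) + 1)⁻¹ • (WithLp.linearEquiv 2 ℝ (Fin n → ℝ)).symm y + v :=
      fun y => by simp [f]
    have hsub : convexHull ℝ (cH n '' (SS (K i) M (N + 1) : Set (Fin n → ℕ))) ⊆
        f ⁻¹' (Metric.cthickening (δ N) (K i)) := by
      refine convexHull_min ?_ (hcv.affine_preimage f)
      rintro _ ⟨z, hz, rfl⟩
      obtain ⟨-, x, hx, hzx⟩ := mem_SS.1 (Finset.mem_coe.1 hz)
      refine Metric.mem_cthickening_of_dist_le _ x _ _ hx ?_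
      rw [hf, EuclideanSpace.dist_eq, Real.sqrt_le_iff]
      refine ⟨by positivity, ?_⟩
      have hb : ∀ j, dist ((((N : ℝ) + 1)⁻¹ • (WithLp.linearEquiv 2 ℝ (Fin n → ℝ)).symm
          (cH n z) + v) j) (x j) ^ 2 ≤ (2 / ((N : ℝ) + 1)) ^ 2 := by
        intro j
        refine pow_le_pow_left₀ dist_nonneg ?_ 2
        have e : (((N : ℝ) + 1)⁻¹ • (WithLp.linearEquiv 2 ℝ (Fin n → ℝ)).symm
          (cH n z) + v) j - x j = ((z j : ℝ) - ((N + 1 : ℕ) : ℝ) * (x j + M)) / ((N : ℝ) + 1) := by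
          simp [v, cH_apply]
          field_simp
          ring
        rw [Real.dist_eq, e, abs_div, abs_of_pos hN]
        gcongr
        exact hzx j
      refine (Finset.sum_le_sum fun j _ => hb j).trans ?_
      have h1 : (1 : ℝ) ≤ n := by exact_mod_cast hn
      have e : δ N ^ 2 = (n : ℝ) * n * (2 / ((N : ℝ) + 1)) ^ 2 := by simp only [δ]; ring
      rw [e, Finset.sum_const, Finset.card_univ, Fintype.card_fin, nsmul_eq_mul]
      gcongr
      nlinarith
    rintro _ ⟨_, ⟨_, ⟨y, hy, rfl⟩, rfl⟩, _, rfl, rfl⟩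
    have := hsub hy
    rw [Set.mem_preimage, hf] at this
    exact this

theorem statement6 (n m k : ℕ) (hk : k ≤ m) (hm : m ≤ n)
    (B : ConvexBody (En n)) (A : Fin m → ConvexBody (En n)) :
    (volume (B : Set (En n))).toReal *
      mixedVol n (List.replicate (n - m) (B : Set (En n)) ++
        List.ofFn fun i => (A i : Set (En n))) ≤
    (m.factorial : ℝ) / (k.factorial * (m - k).factorial) *
      (mixedVol n (List.replicate (n - k) (B : Set (En n)) ++
          List.ofFn fun i : Fin k => (A (Fin.castLE hk i) : Set (En n))) *
       mixedVol n (List.replicate (n - m + k) (B : Set (En n)) ++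
          List.ofFn fun i : Fin (m - k) => (A ⟨k + (i : ℕ), by omega⟩ : Set (En n)))) := by
  rcases Nat.eq_zero_or_pos n with rfl | hn
  · have h0 : ∀ l, mixedVol 0 l = 0 := fun l => by
      simp [mixedVol, Finset.filter_singleton]
    rw [h0, h0, h0]; simp
  · exact ineq_body n m k hn hk hm
      (fun o => Option.elim o (B : Set (En n)) fun i => (A i : Set (En n)))
      (fun i => by cases i with
        | none => exact B.isCompact
        | some i => exact (A i).isCompact)
      (fun i => by cases i with
        | none => exact B.convex
        | some i => exact (A i).convex)
      (fun i => by cases i with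
        | none => exact B.nonempty
        | some i => exact (A i).nonempty)

end ConvexPaper
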